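/- arXiv:1709.05450 — 4 statements merged into one kernel-verified Lean document; each statement's English description precedes it below -/
import Mathlib

section
/- Let F : P_n × P_n → P_n satisfy: (1) for each fixed Y, X ↦ F(X,Y) is concave and F(λX,Y) = λF(X,Y) for all λ > 0; (2) F(UXU*, UYU*) = U F(X,Y) U* for every unitary U; (3) F(X,Y) = X Y^q whenever X and Y commute, for some fixed real q. Then for all positive definite X, Y, Z with Tr[Z] = Tr[X], we have Tr[X log F(Z,Y)] ≤ Tr[X (log X + q log Y)]. -/
open Matrix ComplexOrder

noncomputable def mlog {n : Type*} [Fintype n] [DecidableEq n] (A : Matrix n n ℂ) : Matrix n n ℂ :=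
  cfc Real.log A

noncomputable def mpow {n : Type*} [Fintype n] [DecidableEq n] (A : Matrix n n ℂ) (p : ℝ) :
    Matrix n n ℂ :=
  cfc (fun x : ℝ => x ^ p) A

noncomputable def rtr {n : Type*} [Fintype n] [DecidableEq n] (A : Matrix n n ℂ) : ℝ :=
  A.trace.re

/-- The weighted geometric mean `A #_t B = A^{1/2} (A^{-1/2} B A^{-1/2})^t A^{1/2}`,
defined for all real `t`. -/
noncomputable def gm {n : Type*} [Fintype n] [DecidableEq n] (A B : Matrix n n ℂ) (t : ℝ) :
    Matrix n n ℂ :=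
  mpow A (1 / 2) * mpow (mpow A (-(1 / 2)) * B * mpow A (-(1 / 2))) t * mpow A (1 / 2)

theorem Matrix.PosDef.exists_spectral {n : Type*} [Fintype n] [DecidableEq n]
    {A : Matrix n n ℂ} (hA : A.PosDef) :
    ∃ U ∈ Matrix.unitaryGroup n ℂ, ∃ a : n → ℝ, (∀ i, 0 < a i) ∧
      A = U * diagonal (fun i => (a i : ℂ)) * Uᴴ ∧
      ∀ f : ℝ → ℝ, cfc f A = U * diagonal (fun i => (f (a i) : ℂ)) * Uᴴ := by
  refine ⟨hA.1.eigenvectorUnitary, hA.1.eigenvectorUnitary.2, hA.1.eigenvalues,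
    hA.eigenvalues_pos, ?_, fun f => ?_⟩
  · exact hA.1.spectral_theorem
  · rw [hA.1.cfc_eq]
    rfl

theorem conj_mul_conj_of_mem_unitaryGroup {n : Type*} [Fintype n] [DecidableEq n]
    {C : Matrix n n ℂ} (hC : C ∈ Matrix.unitaryGroup n ℂ) (P Q : Matrix n n ℂ) :
    (C * P * Cᴴ) * (C * Q * Cᴴ) = C * (P * Q) * Cᴴ := by
  have h : Cᴴ * C = 1 := Matrix.mem_unitaryGroup_iff'.1 hC
  calc _ = C * P * (Cᴴ * C) * Q * Cᴴ := by simp only [Matrix.mul_assoc]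
    _ = _ := by rw [h, Matrix.mul_one]; simp only [Matrix.mul_assoc]

theorem star_mulVec_dotProduct_mulVec_of_mem_unitaryGroup {n : Type*} [Fintype n] [DecidableEq n]
    {U : Matrix n n ℂ} (hU : U ∈ Matrix.unitaryGroup n ℂ) (v w : n → ℂ) :
    star (U *ᵥ v) ⬝ᵥ (U *ᵥ w) = star v ⬝ᵥ w := by
  have h : Uᴴ * U = 1 := Matrix.mem_unitaryGroup_iff'.1 hU
  rw [star_mulVec, dotProduct_mulVec, vecMul_vecMul, h, vecMul_one]

theorem sum_re_star_mulVec_mul_mulVec {n : Type*} [Fintype n] [DecidableEq n]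
    {U : Matrix n n ℂ} (hU : U ∈ Matrix.unitaryGroup n ℂ) (v w : n → ℂ) :
    ∑ i, (star ((U *ᵥ v) i) * (U *ᵥ w) i).re = ∑ i, (star (v i) * w i).re := by
  have h := congrArg Complex.re (star_mulVec_dotProduct_mulVec_of_mem_unitaryGroup hU v w)
  simpa only [dotProduct, Complex.re_sum, Pi.star_apply] using h

theorem sum_normSq_mulVec {n : Type*} [Fintype n] [DecidableEq n]
    {U : Matrix n n ℂ} (hU : U ∈ Matrix.unitaryGroup n ℂ) (v : n → ℂ) :
    ∑ i, Complex.normSq ((U *ᵥ v) i) = ∑ i, Complex.normSq (v i) := by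
  have h := sum_re_star_mulVec_mul_mulVec hU v v
  have e : ∀ z : ℂ, (star z * z).re = Complex.normSq z := fun z => by
    simp [Complex.normSq_apply]
  simpa only [e] using h

theorem rtr_conj_diagonal_mul {n : Type*} [Fintype n] [DecidableEq n]
    (A B : Matrix n n ℂ) (x w : n → ℝ) :
    rtr ((A * diagonal (fun i => (x i : ℂ)) * Aᴴ) * (B * diagonal (fun i => (w i : ℂ)) * Bᴴ)) =
      ∑ a, ∑ b, x a * w b * Complex.normSq ((Bᴴ * A) b a) := by
  have h1 : ((A * diagonal (fun i => (x i : ℂ)) * Aᴴ) *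
      (B * diagonal (fun i => (w i : ℂ)) * Bᴴ)).trace =
      ((diagonal (fun i => (x i : ℂ)) * (Bᴴ * A)ᴴ) *
        (diagonal (fun i => (w i : ℂ)) * (Bᴴ * A))).trace := by
    rw [conjTranspose_mul, conjTranspose_conjTranspose]
    simp only [Matrix.mul_assoc]
    rw [Matrix.trace_mul_comm A]
    simp only [Matrix.mul_assoc]
  rw [rtr, h1]
  simp only [trace, diag_apply, mul_apply (M := diagonal _ * (Bᴴ * A)ᴴ), diagonal_mul,
    conjTranspose_apply, Complex.re_sum]
  refine Finset.sum_congr rfl fun a _ => Finset.sum_congr rfl fun b _ => ?_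
  have : (x a : ℂ) * star ((Bᴴ * A) b a) * ((w b : ℂ) * (Bᴴ * A) b a) =
      ((x a * w b * Complex.normSq ((Bᴴ * A) b a) : ℝ) : ℂ) := by
    push_cast
    rw [← Complex.mul_conj]
    simp only [starRingEnd_apply]
    ring
  rw [this, Complex.ofReal_re]

theorem sum_mul_log_le_of_resolvent_le {K I : Type*} [Fintype K] [Fintype I]
    (m α : K → ℝ) (p u r : I → ℝ) (hα : ∀ k, 0 < α k) (hu : ∀ i, 0 < u i)
    (hsum : ∑ k, m k = ∑ i, p i)
    (h : ∀ s : ℝ, 0 < s → ∑ i, (p i * (1 / (s + u i) + u i / (s + u i) ^ 2) - r i / (s + u i) ^ 2)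
      ≤ ∑ k, m k / (s + α k)) :
    ∑ k, m k * Real.log (α k) ≤ ∑ i, (p i * Real.log (u i) - p i + r i / u i) := by
  set G : ℝ → ℝ := fun s => ∑ k, m k * Real.log (s + α k) -
    ∑ i, (p i * (Real.log (s + u i) - u i / (s + u i)) + r i / (s + u i)) with hG
  have hder : ∀ s : ℝ, 0 ≤ s → HasDerivAt G (∑ k, m k / (s + α k) -
      ∑ i, (p i * (1 / (s + u i) + u i / (s + u i) ^ 2) - r i / (s + u i) ^ 2)) s := by
    intro s hs
    refine HasDerivAt.sub (HasDerivAt.fun_sum fun k _ => ?_) (HasDerivAt.fun_sum fun i _ => ?_)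
    · have h0 : s + α k ≠ 0 := by linarith [hα k]
      rw [← mul_one_div]
      exact (((hasDerivAt_id' s).add_const (α k)).log h0).const_mul (m k)
    · have h0 : s + u i ≠ 0 := by linarith [hu i]
      have h1 := (hasDerivAt_id' s).add_const (u i)
      have h2 := (hasDerivAt_const s (u i)).fun_div h1 h0
      have h3 := (hasDerivAt_const s (r i)).fun_div h1 h0
      convert (((h1.log h0).fun_sub h2).const_mul (p i)).fun_add h3 using 1
      ring
  have hmono : MonotoneOn G (Set.Ici 0) := by
    refine monotoneOn_of_deriv_nonneg (convex_Ici 0)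
      (fun s hs => (hder s hs).continuousAt.continuousWithinAt) ?_ ?_
    · intro s hs
      rw [interior_Ici] at hs
      exact (hder s (le_of_lt hs)).differentiableAt.differentiableWithinAt
    · intro s hs
      rw [interior_Ici] at hs
      rw [(hder s (le_of_lt hs)).deriv]
      linarith [h s hs]
  have hGeq : ∀ s : ℝ, G s = ∑ k, m k * (Real.log (s + α k) - Real.log s) -
      ∑ i, (p i * ((Real.log (s + u i) - Real.log s) - u i / (s + u i)) + r i / (s + u i)) := by
    intro s
    have e1 : ∑ k, m k * (Real.log (s + α k) - Real.log s) =
        ∑ k, m k * Real.log (s + α k) - (∑ k, m k) * Real.log s := by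
      rw [Finset.sum_mul, ← Finset.sum_sub_distrib]
      exact Finset.sum_congr rfl fun _ _ => by ring
    have e2 : ∑ i, (p i * ((Real.log (s + u i) - Real.log s) - u i / (s + u i)) + r i / (s + u i)) =
        ∑ i, (p i * (Real.log (s + u i) - u i / (s + u i)) + r i / (s + u i)) -
          (∑ i, p i) * Real.log s := by
      rw [Finset.sum_mul, ← Finset.sum_sub_distrib]
      exact Finset.sum_congr rfl fun _ _ => by ring
    rw [e1, e2, hsum, hG]
    ring
  have hlim : Filter.Tendsto G Filter.atTop (nhds 0) := by
    rw [funext hGeq]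
    have hdiv : ∀ c d : ℝ, Filter.Tendsto (fun s : ℝ => c / (s + d)) Filter.atTop (nhds 0) :=
      fun c d => tendsto_const_nhds.div_atTop
        (Filter.tendsto_atTop_add_const_right _ d Filter.tendsto_id)
    have h1 : Filter.Tendsto (fun s : ℝ => ∑ k, m k * (Real.log (s + α k) - Real.log s))
        Filter.atTop (nhds (∑ k, m k * 0)) :=
      tendsto_finsetSum _ fun k _ => (Real.tendsto_log_comp_add_sub_log (α k)).const_mul (m k)
    have h2 : Filter.Tendsto (fun s : ℝ => ∑ i, (p i * ((Real.log (s + u i) - Real.log s) -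
        u i / (s + u i)) + r i / (s + u i))) Filter.atTop (nhds (∑ i, (p i * (0 - 0) + 0))) :=
      tendsto_finsetSum _ fun i _ =>
        (((Real.tendsto_log_comp_add_sub_log (u i)).sub (hdiv _ _)).const_mul (p i)).add (hdiv _ _)
    simpa using h1.sub h2
  have hG0 : G 0 ≤ 0 := by
    refine ge_of_tendsto hlim ?_
    filter_upwards [Filter.eventually_ge_atTop (0 : ℝ)] with s hs
    exact hmono Set.self_mem_Ici hs hs
  have hfin : ∑ i, (p i * (Real.log (0 + u i) - u i / (0 + u i)) + r i / (0 + u i)) =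
      ∑ i, (p i * Real.log (u i) - p i + r i / u i) := by
    refine Finset.sum_congr rfl fun i _ => ?_
    rw [zero_add, div_self (hu i).ne']
    ring
  simp only [hG] at hG0
  rw [hfin] at hG0
  simp only [zero_add] at hG0
  linarith

theorem two_mul_re_sub_le_div (c d : ℂ) {t : ℝ} (ht : 0 < t) :
    2 * (star c * d).re - t * Complex.normSq d ≤ Complex.normSq c / t := by
  rw [le_div_iff₀ ht]
  simp only [Complex.star_def, Complex.mul_re, Complex.conj_re, Complex.conj_im,
    Complex.normSq_apply]
  nlinarith [sq_nonneg (c.re - t * d.re), sq_nonneg (c.im - t * d.im)]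

/-- A Golden-Thompson type inequality in variational form: the operator `log W + log V` is
compared with the weighted trace of `W V`, the eigenbases of `X` and `W` being given by the
columns of the unitaries `A` and `B`, and `V⁻¹` being diagonal with entries `u`. -/
theorem sum_mul_log_le_entropy_add {n : Type*} [Fintype n] [DecidableEq n]
    {A B : Matrix n n ℂ} (hA : A ∈ Matrix.unitaryGroup n ℂ) (hB : B ∈ Matrix.unitaryGroup n ℂ)
    {x w u : n → ℝ} (hx : ∀ i, 0 < x i) (hw : ∀ i, 0 < w i) (hu : ∀ i, 0 < u i) :
    ∑ a, ∑ b, x a * Real.log (w b) * Complex.normSq ((Bᴴ * A) b a) ≤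
      ∑ a, x a * Real.log (x a) +
        ∑ a, ∑ i, x a * Real.log (u i) * Complex.normSq (A i a) - ∑ a, x a +
        ∑ b, ∑ i, w b * (u i)⁻¹ * Complex.normSq (B i b) := by
  have hA' : Aᴴ ∈ Matrix.unitaryGroup n ℂ := Unitary.star_mem hA
  have hB' : Bᴴ ∈ Matrix.unitaryGroup n ℂ := Unitary.star_mem hB
  have hcol : ∀ {U : Matrix n n ℂ}, U ∈ Matrix.unitaryGroup n ℂ → ∀ a,
      ∑ i, Complex.normSq (U i a) = 1 := by
    intro U hU a
    have h := sum_normSq_mulVec hU (Pi.single a 1)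
    simpa [Pi.single_apply, apply_ite Complex.normSq] using h
  have hC : Bᴴ * A ∈ Matrix.unitaryGroup n ℂ := mul_mem hB' hA
  set D : (n → ℝ) → Matrix n n ℂ := fun t => Bᴴ * diagonal (fun i => (t i : ℂ)) * A with hD
  have hDcol : ∀ t a, (fun b => D t b a) = Bᴴ *ᵥ (fun i => (t i : ℂ) * A i a) := by
    intro t a
    ext b
    simp [hD, Matrix.mul_assoc, mul_apply (M := Bᴴ), mulVec, dotProduct, diagonal_mul]
  have hCcol : ∀ a, (fun b => (Bᴴ * A) b a) = Bᴴ *ᵥ (fun i => A i a) := by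
    intro a
    ext b
    simp [mul_apply, mulVec, dotProduct]
  have hDrow : ∀ t b, (fun a => star (D t b a)) = Aᴴ *ᵥ (fun i => (t i : ℂ) * B i b) := by
    intro t b
    ext a
    simp only [hD, mul_apply (N := A), mul_diagonal, mulVec, dotProduct, conjTranspose_apply,
      star_sum, star_mul', Complex.star_def, Complex.conj_ofReal]
    refine Finset.sum_congr rfl fun i _ => by simp; ring
  have hnC : ∀ (t : ℝ) (z : ℂ), Complex.normSq ((t : ℂ) * z) = t ^ 2 * Complex.normSq z := by
    intro t z
    rw [Complex.normSq_mul, Complex.normSq_ofReal, sq]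
  have hI1 : ∀ t a, ∑ b, Complex.normSq (D t b a) = ∑ i, t i ^ 2 * Complex.normSq (A i a) := by
    intro t a
    have h := sum_normSq_mulVec hB' (fun i => (t i : ℂ) * A i a)
    rw [← hDcol] at h
    simpa only [hnC] using h
  have hI2 : ∀ t b, ∑ a, Complex.normSq (D t b a) = ∑ i, t i ^ 2 * Complex.normSq (B i b) := by
    intro t b
    have h := sum_normSq_mulVec hA' (fun i => (t i : ℂ) * B i b)
    rw [← hDrow] at h
    simpa only [hnC, Complex.star_def, Complex.normSq_conj] using h
  have hI3 : ∀ t a, ∑ b, (star ((Bᴴ * A) b a) * D t b a).re =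
      ∑ i, t i * Complex.normSq (A i a) := by
    intro t a
    have h := sum_re_star_mulVec_mul_mulVec hB' (fun i => A i a) (fun i => (t i : ℂ) * A i a)
    rw [← hDcol, ← hCcol] at h
    rw [h]
    refine Finset.sum_congr rfl fun i _ => ?_
    simp [Complex.normSq_apply]
    ring
  have key := sum_mul_log_le_of_resolvent_le (K := n × n)
    (fun k => x k.1 * Complex.normSq ((Bᴴ * A) k.2 k.1)) (fun k => w k.2 / x k.1)
    (fun i => ∑ a, x a * Complex.normSq (A i a)) u (fun i => ∑ b, w b * Complex.normSq (B i b))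
    (fun k => div_pos (hw _) (hx _)) hu ?_ ?_
  · rw [Fintype.sum_prod_type] at key
    have e1 : ∑ a, ∑ b, x a * Complex.normSq ((Bᴴ * A) b a) * Real.log (w b / x a) =
        ∑ a, ∑ b, x a * Real.log (w b) * Complex.normSq ((Bᴴ * A) b a) -
          ∑ a, x a * Real.log (x a) := by
      rw [← Finset.sum_sub_distrib]
      refine Finset.sum_congr rfl fun a _ => ?_
      have : x a * Real.log (x a) =
          ∑ b, x a * Real.log (x a) * Complex.normSq ((Bᴴ * A) b a) := by
        rw [← Finset.mul_sum, hcol hC, mul_one]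
      rw [this, ← Finset.sum_sub_distrib]
      refine Finset.sum_congr rfl fun b _ => ?_
      rw [Real.log_div (hw b).ne' (hx a).ne']
      ring
    have e2 : ∑ i, ∑ a, x a * Complex.normSq (A i a) = ∑ a, x a := by
      rw [Finset.sum_comm]
      refine Finset.sum_congr rfl fun a _ => ?_
      rw [← Finset.mul_sum, hcol hA, mul_one]
    rw [Finset.sum_add_distrib, Finset.sum_sub_distrib, e2] at key
    simp only [Finset.sum_mul, Finset.sum_div] at key
    rw [Finset.sum_comm (f := fun i a => x a * Complex.normSq (A i a) * Real.log (u i)),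
      Finset.sum_comm (f := fun i b => w b * Complex.normSq (B i b) / u i)] at key
    have e3 : ∑ a, ∑ i, x a * Complex.normSq (A i a) * Real.log (u i) =
        ∑ a, ∑ i, x a * Real.log (u i) * Complex.normSq (A i a) :=
      Finset.sum_congr rfl fun a _ => Finset.sum_congr rfl fun i _ => by ring
    have e4 : ∑ b, ∑ i, w b * Complex.normSq (B i b) / u i =
        ∑ b, ∑ i, w b * (u i)⁻¹ * Complex.normSq (B i b) :=
      Finset.sum_congr rfl fun a _ => Finset.sum_congr rfl fun i _ => by ring
    rw [e1, e3, e4] at key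
    linarith
  · rw [Fintype.sum_prod_type, Finset.sum_comm (f := fun i a => x a * Complex.normSq (A i a))]
    refine Finset.sum_congr rfl fun a _ => ?_
    simp only
    rw [← Finset.mul_sum, ← Finset.mul_sum, hcol hC, hcol hA]
  · intro s hs
    set t : n → ℝ := fun i => 1 / (s + u i) with ht
    have hle : ∀ a b, 2 * (x a * (star ((Bᴴ * A) b a) * D t b a).re) -
        s * (x a * Complex.normSq (D t b a)) - w b * Complex.normSq (D t b a) ≤
        x a * Complex.normSq ((Bᴴ * A) b a) / (s + w b / x a) := by
      intro a b
      have h := mul_le_mul_of_nonneg_left (two_mul_re_sub_le_div ((Bᴴ * A) b a) (D t b a)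
        (add_pos hs (div_pos (hw b) (hx a)))) (hx a).le
      have e : x a * (2 * (star ((Bᴴ * A) b a) * D t b a).re -
          (s + w b / x a) * Complex.normSq (D t b a)) =
          2 * (x a * (star ((Bᴴ * A) b a) * D t b a).re) -
          s * (x a * Complex.normSq (D t b a)) - w b * Complex.normSq (D t b a) := by
        have := (hx a).ne'
        field_simp
        ring
      rw [e] at h
      rwa [mul_div_assoc]
    rw [Fintype.sum_prod_type]
    refine le_trans (le_of_eq ?_)
      (Finset.sum_le_sum fun a _ => Finset.sum_le_sum fun b _ => hle a b)
    simp only [Finset.sum_sub_distrib, ← Finset.mul_sum, hI1, hI3]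
    rw [Finset.sum_comm (f := fun a b => w b * Complex.normSq (D t b a))]
    simp only [← Finset.mul_sum, hI2]
    simp only [Finset.mul_sum, Finset.sum_mul, Finset.sum_div]
    rw [Finset.sum_comm (f := fun i a => x a * Complex.normSq (A i a) * _),
      Finset.sum_comm (f := fun i b => w b * Complex.normSq (B i b) / _)]
    congr 1
    · rw [← Finset.sum_sub_distrib]
      refine Finset.sum_congr rfl fun a _ => ?_
      rw [← Finset.sum_sub_distrib]
      refine Finset.sum_congr rfl fun i _ => ?_
      have : s + u i ≠ 0 := by linarith [hu i]
      simp only [ht]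
      field_simp
      ring
    · refine Finset.sum_congr rfl fun a _ => Finset.sum_congr rfl fun i _ => ?_
      simp only [ht, div_eq_mul_inv, one_mul, inv_pow]
      generalize ((s + u i) ^ 2)⁻¹ = z
      ring

theorem rtr_mul_mlog_le {n : Type*} [Fintype n] [DecidableEq n] {X W Y : Matrix n n ℂ} (q : ℝ)
    (hX : X.PosDef) (hW : W.PosDef) (hY : Y.PosDef)
    (h : rtr (W * mpow Y (-q)) ≤ rtr X) :
    rtr (X * mlog W) ≤ rtr (X * (mlog X + q • mlog Y)) := by
  obtain ⟨A, hA, x, hx, hXe, hXf⟩ := hX.exists_spectral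
  obtain ⟨B, hB, w, hw, hWe, hWf⟩ := hW.exists_spectral
  obtain ⟨C, hC, y, hy, hYe, hYf⟩ := hY.exists_spectral
  have hC' : Cᴴ ∈ Matrix.unitaryGroup n ℂ := Unitary.star_mem hC
  have hCC : C * Cᴴ = 1 := Matrix.mem_unitaryGroup_iff.1 hC
  have hAA : Aᴴ * A = 1 := Matrix.mem_unitaryGroup_iff'.1 hA
  have key := sum_mul_log_le_entropy_add (mul_mem hC' hA) (mul_mem hC' hB) hx hw
    (fun i => Real.rpow_pos_of_pos (hy i) q)
  have hBA : (Cᴴ * B)ᴴ * (Cᴴ * A) = Bᴴ * A := by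
    rw [conjTranspose_mul, conjTranspose_conjTranspose, Matrix.mul_assoc, ← Matrix.mul_assoc C,
      hCC, Matrix.one_mul]
  have t1 : rtr (X * mlog W) =
      ∑ a, ∑ b, x a * Real.log (w b) * Complex.normSq ((Bᴴ * A) b a) := by
    rw [mlog, hWf, hXe]
    exact rtr_conj_diagonal_mul A B x fun b => Real.log (w b)
  have t2 : rtr (X * mlog X) = ∑ a, x a * Real.log (x a) := by
    rw [mlog, hXf]
    nth_rewrite 1 [hXe]
    refine (rtr_conj_diagonal_mul A A x fun b => Real.log (x b)).trans ?_
    simp [hAA, Matrix.one_apply, apply_ite Complex.normSq]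
  have t3 : q * rtr (X * mlog Y) =
      ∑ a, ∑ i, x a * Real.log (y i ^ q) * Complex.normSq ((Cᴴ * A) i a) := by
    rw [mlog, hYf, hXe]
    rw [rtr_conj_diagonal_mul A C x fun b => Real.log (y b)]
    simp only [Finset.mul_sum]
    refine Finset.sum_congr rfl fun a _ => Finset.sum_congr rfl fun i _ => ?_
    rw [Real.log_rpow (hy i)]
    ring
  have t4 : rtr (W * mpow Y (-q)) =
      ∑ b, ∑ i, w b * (y i ^ q)⁻¹ * Complex.normSq ((Cᴴ * B) i b) := by
    rw [mpow, hYf, hWe]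
    rw [rtr_conj_diagonal_mul B C w fun b => y b ^ (-q)]
    refine Finset.sum_congr rfl fun a _ => Finset.sum_congr rfl fun i _ => ?_
    rw [Real.rpow_neg (hy i).le]
  have t5 : rtr X = ∑ a, x a := by
    rw [rtr, hXe, Matrix.trace_mul_comm, ← Matrix.mul_assoc, hAA, Matrix.one_mul]
    simp [trace]
  have t6 : rtr (X * (mlog X + q • mlog Y)) = rtr (X * mlog X) + q * rtr (X * mlog Y) := by
    simp [rtr, Matrix.mul_add]
  rw [hBA, ← t1, ← t2, ← t3, ← t4, ← t5] at key
  rw [t6]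
  linarith

theorem Matrix.PosSemidef.rtr_mul_mpow_nonneg {n : Type*} [Fintype n] [DecidableEq n]
    {P Y : Matrix n n ℂ} (hP : P.PosSemidef) (hY : Y.PosDef) (q : ℝ) :
    0 ≤ rtr (P * mpow Y q) := by
  obtain ⟨C, hC, y, hy, hYe, hYf⟩ := hY.exists_spectral
  have h : (P * mpow Y q).trace =
      ((Cᴴ * P * C) * diagonal (fun i => ((y i ^ q : ℝ) : ℂ))).trace := by
    rw [mpow, hYf, ← Matrix.mul_assoc, Matrix.trace_mul_comm]
    simp only [Matrix.mul_assoc]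
  rw [rtr, h]
  simp only [trace, diag_apply, mul_diagonal, Complex.re_sum]
  refine Finset.sum_nonneg fun i _ => ?_
  have h1 := (hP.conjTranspose_mul_mul_same C).diag_nonneg (i := i)
  have h2 : 0 ≤ ((Cᴴ * P * C) i i).re := (Complex.le_def.1 h1).1
  rw [Complex.re_mul_ofReal]
  exact mul_nonneg h2 (Real.rpow_pos_of_pos (hy i) q).le

theorem mpow_mul_mpow_neg {n : Type*} [Fintype n] [DecidableEq n] {Y : Matrix n n ℂ}
    (hY : Y.PosDef) (q : ℝ) : mpow Y q * mpow Y (-q) = 1 := by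
  obtain ⟨C, hC, y, hy, hYe, hYf⟩ := hY.exists_spectral
  have hCC : C * Cᴴ = 1 := Matrix.mem_unitaryGroup_iff.1 hC
  have h : ∀ i, ((y i ^ q : ℝ) : ℂ) * ((y i ^ (-q) : ℝ) : ℂ) = 1 := fun i => by
    rw [← Complex.ofReal_mul, ← Real.rpow_add (hy i)]
    simp
  rw [mpow, mpow, hYf, hYf]
  rw [conj_mul_conj_of_mem_unitaryGroup hC, diagonal_mul_diagonal]
  simp only [h]
  rw [diagonal_one, Matrix.mul_one, hCC]

theorem diagonal_intUnits_mem_unitaryGroup {n : Type*} [Fintype n] [DecidableEq n] (ε : n → ℤˣ) :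
    diagonal (fun i => ((ε i : ℤ) : ℂ)) ∈ Matrix.unitaryGroup n ℂ := by
  rw [Matrix.mem_unitaryGroup_iff, star_eq_conjTranspose, diagonal_conjTranspose,
    diagonal_mul_diagonal, ← diagonal_one]
  congr 1
  ext i
  rcases Int.units_eq_one_or (ε i) with h | h <;> simp [h]

theorem sum_diagonal_intUnits_conj_apply_eq_zero {n : Type*} [Fintype n] [DecidableEq n]
    (M : Matrix n n ℂ) {i j : n} (hij : i ≠ j) :
    (∑ ε : n → ℤˣ, diagonal (fun i => ((ε i : ℤ) : ℂ)) * M *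
      (diagonal (fun i => ((ε i : ℤ) : ℂ)))ᴴ) i j = 0 := by
  simp only [Matrix.sum_apply, diagonal_conjTranspose, mul_diagonal, diagonal_mul]
  refine self_eq_neg.1 ?_
  rw [← Finset.sum_neg_distrib]
  refine Fintype.sum_equiv (Equiv.mulLeft (Pi.mulSingle i (-1))) _ _ fun ε => ?_
  simp [Pi.mulSingle_eq_of_ne hij.symm]

theorem stmt0 {n : Type*} [Fintype n] [DecidableEq n]
    (F : Matrix n n ℂ → Matrix n n ℂ → Matrix n n ℂ) (q : ℝ)
    (hmaps : ∀ X Y : Matrix n n ℂ, X.PosDef → Y.PosDef → (F X Y).PosDef)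
    (hconc : ∀ X₁ X₂ Y : Matrix n n ℂ, X₁.PosDef → X₂.PosDef → Y.PosDef →
      ∀ t : ℝ, t ∈ Set.Icc (0 : ℝ) 1 →
        (F ((1 - t) • X₁ + t • X₂) Y - ((1 - t) • F X₁ Y + t • F X₂ Y)).PosSemidef)
    (hhom : ∀ (X Y : Matrix n n ℂ) (l : ℝ), 0 < l → X.PosDef → Y.PosDef →
      F (l • X) Y = l • F X Y)
    (huni : ∀ (X Y : Matrix n n ℂ) (U : Matrix n n ℂ), U ∈ Matrix.unitaryGroup n ℂ →
      X.PosDef → Y.PosDef → F (U * X * Uᴴ) (U * Y * Uᴴ) = U * F X Y * Uᴴ)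
    (hcomm : ∀ X Y : Matrix n n ℂ, X.PosDef → Y.PosDef → X * Y = Y * X →
      F X Y = X * mpow Y q)
    (X Y Z : Matrix n n ℂ) (hX : X.PosDef) (hY : Y.PosDef) (hZ : Z.PosDef)
    (htr : Z.trace = X.trace) :
    rtr (X * mlog (F Z Y)) ≤ rtr (X * (mlog X + q • mlog Y)) := by
  refine rtr_mul_mlog_le q hX (hmaps Z Y hZ hY) hY ?_
  have hXZ : rtr X = rtr Z := by rw [rtr, rtr, htr]
  rw [hXZ]
  set g : Matrix n n ℂ → ℝ := fun A => rtr (F A Y * mpow Y (-q)) with hg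
  have hsuper : ∀ A B : Matrix n n ℂ, A.PosDef → B.PosDef → g A + g B ≤ g (A + B) := by
    intro A B hA hB
    have hA2 : ((2 : ℝ) • A).PosDef := hA.smul two_pos
    have hB2 : ((2 : ℝ) • B).PosDef := hB.smul two_pos
    have h := hconc _ _ Y hA2 hB2 hY (1 / 2) ⟨by norm_num, by norm_num⟩
    rw [hhom A Y 2 two_pos hA hY, hhom B Y 2 two_pos hB hY] at h
    simp only [smul_smul] at h
    norm_num at h
    have h1 := h.rtr_mul_mpow_nonneg hY (-q)
    simp only [rtr, Matrix.sub_mul, Matrix.add_mul, trace_sub, trace_add, Complex.sub_re,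
      Complex.add_re] at h1
    simp only [hg, rtr]
    linarith
  have hsum : ∀ (s : Finset (n → ℤˣ)) (f : (n → ℤˣ) → Matrix n n ℂ), s.Nonempty →
      (∀ e, (f e).PosDef) → (∑ e ∈ s, f e).PosDef ∧ ∑ e ∈ s, g (f e) ≤ g (∑ e ∈ s, f e) := by
    intro s f hs hf
    induction hs using Finset.Nonempty.cons_induction with
    | singleton a => simp [hf a]
    | cons a s ha hs ih =>
      rw [Finset.sum_cons, Finset.sum_cons]
      exact ⟨(hf a).add ih.1, by linarith [hsuper _ _ (hf a) ih.1, ih.2]⟩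
  obtain ⟨C, hC, y, hy, hYe, hYf⟩ := hY.exists_spectral
  have hC' : Cᴴ ∈ Matrix.unitaryGroup n ℂ := Unitary.star_mem hC
  set S : (n → ℤˣ) → Matrix n n ℂ := fun ε => diagonal (fun i => ((ε i : ℤ) : ℂ)) with hS
  set U : (n → ℤˣ) → Matrix n n ℂ := fun ε => C * S ε * Cᴴ with hUdef
  have hU : ∀ ε, U ε ∈ Matrix.unitaryGroup n ℂ := fun ε =>
    mul_mem (mul_mem hC (diagonal_intUnits_mem_unitaryGroup ε)) hC'
  have hUU : ∀ ε, (U ε)ᴴ * U ε = 1 := fun ε => Matrix.mem_unitaryGroup_iff'.1 (hU ε)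
  have hUU' : ∀ ε, U ε * (U ε)ᴴ = 1 := fun ε => Matrix.mem_unitaryGroup_iff.1 (hU ε)
  have hUY : ∀ ε, U ε * Y = Y * U ε := by
    intro ε
    rw [hYe, hUdef]
    simp only
    rw [conj_mul_conj_of_mem_unitaryGroup hC, conj_mul_conj_of_mem_unitaryGroup hC, hS]
    simp only [diagonal_mul_diagonal, mul_comm]
  have hUYU : ∀ ε, U ε * Y * (U ε)ᴴ = Y := by
    intro ε
    rw [hUY, Matrix.mul_assoc, hUU', Matrix.mul_one]
  have hUpow : ∀ ε p, mpow Y p * U ε = U ε * mpow Y p := by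
    intro ε p
    exact (Commute.cfc_real (show Commute Y (U ε) from (hUY ε).symm) _).eq
  have hZU : ∀ ε, (U ε * Z * (U ε)ᴴ).PosDef := fun ε =>
    (Matrix.IsUnit.posDef_star_right_conjugate_iff
      (Unitary.toUnits ⟨U ε, hU ε⟩).isUnit).2 hZ
  have hgU : ∀ ε, g (U ε * Z * (U ε)ᴴ) = g Z := by
    intro ε
    have h := huni Z Y (U ε) (hU ε) hZ hY
    rw [hUYU] at h
    simp only [hg, rtr]
    rw [h, Matrix.trace_mul_comm, ← Matrix.mul_assoc, ← Matrix.mul_assoc, hUpow,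
      Matrix.trace_mul_comm, ← Matrix.mul_assoc, ← Matrix.mul_assoc, hUU, Matrix.one_mul,
      Matrix.trace_mul_comm]
  obtain ⟨hM, hle⟩ := hsum Finset.univ (fun ε => U ε * Z * (U ε)ᴴ) Finset.univ_nonempty hZU
  set M := ∑ ε : n → ℤˣ, U ε * Z * (U ε)ᴴ with hMdef
  have hMC : M = C * (∑ ε : n → ℤˣ, S ε * (Cᴴ * Z * C) * (S ε)ᴴ) * Cᴴ := by
    rw [hMdef, Finset.mul_sum, Finset.sum_mul]
    refine Finset.sum_congr rfl fun ε _ => ?_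
    simp only [hUdef, conjTranspose_mul, conjTranspose_conjTranspose, Matrix.mul_assoc]
  have hdiag : ∃ d : n → ℂ, M = C * diagonal d * Cᴴ := by
    refine ⟨fun i => (∑ ε : n → ℤˣ, S ε * (Cᴴ * Z * C) * (S ε)ᴴ) i i, ?_⟩
    rw [hMC]
    congr 2
    ext i j
    by_cases hij : i = j
    · subst hij
      simp
    · rw [diagonal_apply_ne _ hij]
      exact sum_diagonal_intUnits_conj_apply_eq_zero _ hij
  have hMY : M * Y = Y * M := by
    obtain ⟨d, hd⟩ := hdiag
    rw [hd, hYe, conj_mul_conj_of_mem_unitaryGroup hC, conj_mul_conj_of_mem_unitaryGroup hC]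
    simp only [diagonal_mul_diagonal, mul_comm]
  have hgM : g M = rtr M := by
    simp only [hg]
    rw [hcomm M Y hM hY hMY, Matrix.mul_assoc, mpow_mul_mpow_neg hY, Matrix.mul_one]
  have htrM : rtr M = Fintype.card (n → ℤˣ) * rtr Z := by
    have : ∀ ε, (U ε * Z * (U ε)ᴴ).trace = Z.trace := fun ε => by
      rw [Matrix.trace_mul_comm, ← Matrix.mul_assoc, hUU, Matrix.one_mul]
    rw [hMdef, rtr, trace_sum, Complex.re_sum]
    simp only [this, Finset.sum_const, Finset.card_univ, nsmul_eq_mul, rtr]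
  simp only [hgU, Finset.sum_const, Finset.card_univ, nsmul_eq_mul] at hle
  rw [hgM, htrM] at hle
  exact le_of_mul_le_mul_left hle (Nat.cast_pos.2 Fintype.card_pos)
end

section
/- For all n×n positive definite matrices X, Y, Z with Tr[Z] = Tr[X] and all p > 0, Tr[X log(Y^{p/2} Z^p Y^{p/2})] ≤ Tr[X (log X^p + log Y^p)]. -/
open Matrix ComplexOrder

open Filter Topology MeasureTheory

section FunctionalCalculus

variable {n : Type*} [Fintype n] [DecidableEq n] {A B X : Matrix n n ℂ}

theorem continuousOn_spectrum (A : Matrix n n ℂ) (f : ℝ → ℝ) :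
    ContinuousOn f (spectrum ℝ A) :=
  A.finite_real_spectrum.continuousOn f

theorem continuousOn_image_spectrum (A : Matrix n n ℂ) (f g : ℝ → ℝ) :
    ContinuousOn g (f '' spectrum ℝ A) :=
  (A.finite_real_spectrum.image f).continuousOn g

theorem cfc_eq_eigenvectorUnitary_mul (hA : A.IsHermitian) (f : ℝ → ℝ) :
    cfc f A = (hA.eigenvectorUnitary : Matrix n n ℂ) *
      diagonal (fun i => (f (hA.eigenvalues i) : ℂ)) *
      star (hA.eigenvectorUnitary : Matrix n n ℂ) := by
  rw [hA.cfc_eq f, IsHermitian.cfc, Unitary.conjStarAlgAut_apply]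
  rfl

theorem eq_eigenvectorUnitary_mul (hA : A.IsHermitian) :
    A = (hA.eigenvectorUnitary : Matrix n n ℂ) *
      diagonal (fun i => (hA.eigenvalues i : ℂ)) *
      star (hA.eigenvectorUnitary : Matrix n n ℂ) := by
  conv_lhs => rw [← cfc_id ℝ A hA.isSelfAdjoint, cfc_eq_eigenvectorUnitary_mul hA]
  rfl

theorem pos_of_mem_spectrum (hA : A.PosDef) {x : ℝ} (hx : x ∈ spectrum ℝ A) : 0 < x := by
  rw [hA.1.spectrum_real_eq_range_eigenvalues] at hx
  obtain ⟨i, rfl⟩ := hx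
  exact hA.eigenvalues_pos i

theorem posDef_cfc (hA : A.PosDef) {f : ℝ → ℝ} (hf : ∀ x, 0 < x → 0 < f x) :
    (cfc f A).PosDef := by
  have h : (cfc f A).IsHermitian := cfc_predicate f A
  rw [h.posDef_iff_eigenvalues_pos]
  intro i
  have hi := h.eigenvalues_mem_spectrum_real i
  rw [cfc_map_spectrum f A hA.1.isSelfAdjoint (continuousOn_spectrum A f)] at hi
  obtain ⟨x, hx, hxi⟩ := hi
  rw [← hxi]
  exact hf x (pos_of_mem_spectrum hA hx)

/-! ### Powers and logarithms of positive definite matrices -/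

theorem posDef_mpow (hA : A.PosDef) (s : ℝ) : (mpow A s).PosDef :=
  posDef_cfc hA fun _ hx => Real.rpow_pos_of_pos hx s

theorem mpow_mul_mpow (hA : A.PosDef) (s t : ℝ) : mpow A s * mpow A t = mpow A (s + t) := by
  unfold mpow
  rw [← cfc_mul _ _ A (continuousOn_spectrum A _) (continuousOn_spectrum A _)]
  exact cfc_congr fun x hx => (Real.rpow_add (pos_of_mem_spectrum hA hx) s t).symm

theorem mpow_zero (hA : A.PosDef) : mpow A 0 = 1 := by
  unfold mpow
  simp only [Real.rpow_zero]
  exact cfc_const_one ℝ A hA.1.isSelfAdjoint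

theorem mpow_one (hA : A.PosDef) : mpow A 1 = A := by
  unfold mpow
  simp only [Real.rpow_one]
  exact cfc_id' ℝ A hA.1.isSelfAdjoint

theorem mpow_mpow (hA : A.PosDef) (s t : ℝ) : mpow (mpow A s) t = mpow A (s * t) := by
  unfold mpow
  rw [← cfc_comp' (fun x : ℝ => x ^ t) (fun x : ℝ => x ^ s) A
    (continuousOn_image_spectrum A _ _) (continuousOn_spectrum A _) hA.1.isSelfAdjoint]
  exact cfc_congr fun x hx => (Real.rpow_mul (pos_of_mem_spectrum hA hx).le s t).symm

theorem mlog_mpow (hA : A.PosDef) (s : ℝ) : mlog (mpow A s) = s • mlog A := by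
  unfold mpow mlog
  rw [← cfc_comp' Real.log (fun x : ℝ => x ^ s) A
    (continuousOn_image_spectrum A _ _) (continuousOn_spectrum A _) hA.1.isSelfAdjoint,
    ← cfc_const_mul s _ A (continuousOn_spectrum A _)]
  exact cfc_congr fun x hx => Real.log_rpow (pos_of_mem_spectrum hA hx) s

theorem mpow_neg_one (hA : A.PosDef) : mpow A (-1) = A⁻¹ := by
  refine (inv_eq_left_inv ?_).symm
  conv_lhs => enter [2]; rw [← mpow_one hA]
  rw [mpow_mul_mpow hA, neg_add_cancel, mpow_zero hA]

theorem posDef_conj (hA : A.PosDef) (hB : B.PosDef) : (B * A * B).PosDef := by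
  have h := hA.conjTranspose_mul_mul_same (mulVec_injective_of_isUnit hB.isUnit)
  rwa [hB.1.eq] at h

/-! ### Trace formulas -/

theorem rtr_add (A B : Matrix n n ℂ) : rtr (A + B) = rtr A + rtr B := by simp [rtr]

theorem rtr_sub (A B : Matrix n n ℂ) : rtr (A - B) = rtr A - rtr B := by simp [rtr]

theorem rtr_smul (s : ℝ) (A : Matrix n n ℂ) : rtr (s • A) = s * rtr A := by
  simp [rtr, trace_smul]

theorem sum_norm_sq_row {U : Matrix n n ℂ} (hU : U ∈ unitaryGroup n ℂ) (i : n) :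
    ∑ j, ‖U i j‖ ^ 2 = 1 := by
  have h := congrFun (congrFun (mem_unitaryGroup_iff.1 hU) i) i
  rw [mul_apply, one_apply_eq] at h
  have h' : ((∑ j, ‖U i j‖ ^ 2 : ℝ) : ℂ) = 1 := by
    rw [← h]
    push_cast
    exact Finset.sum_congr rfl fun j _ => by
      rw [star_apply, Complex.star_def, Complex.mul_conj']
  exact_mod_cast h'

theorem sum_norm_sq_col {U : Matrix n n ℂ} (hU : U ∈ unitaryGroup n ℂ) (j : n) :
    ∑ i, ‖U i j‖ ^ 2 = 1 := by
  have h := sum_norm_sq_row (Unitary.star_mem hU) j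
  simpa [star_apply] using h

theorem rtr_diagonal_mul_conj (a b : n → ℝ) (W : Matrix n n ℂ) :
    rtr (diagonal (fun i => (a i : ℂ)) * (W * diagonal (fun i => (b i : ℂ)) * star W)) =
      ∑ i, ∑ j, ‖W i j‖ ^ 2 * (a i * b j) := by
  rw [rtr, trace, Complex.re_sum]
  refine Finset.sum_congr rfl fun i _ => ?_
  rw [diag_apply, diagonal_mul, mul_apply, Finset.mul_sum, Complex.re_sum]
  refine Finset.sum_congr rfl fun j _ => ?_
  rw [mul_diagonal, star_apply, Complex.star_def]
  have : (a i : ℂ) * (W i j * (b j : ℂ) * (starRingEnd ℂ) (W i j)) =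
      ((‖W i j‖ ^ 2 * (a i * b j) : ℝ) : ℂ) := by
    push_cast
    rw [← Complex.mul_conj']
    ring
  rw [this, Complex.ofReal_re]

theorem rtr_cfc (hA : A.IsHermitian) (f : ℝ → ℝ) :
    rtr (cfc f A) = ∑ i, f (hA.eigenvalues i) := by
  rw [cfc_eq_eigenvectorUnitary_mul hA, rtr, trace_mul_comm, ← mul_assoc,
    Unitary.coe_star_mul_self, one_mul, trace_diagonal, Complex.re_sum]
  simp

/-- The overlap matrix between the eigenbases of two Hermitian matrices. -/
noncomputable def eigenOverlap (hA : A.IsHermitian) (hB : B.IsHermitian) : Matrix n n ℂ :=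
  star (hA.eigenvectorUnitary : Matrix n n ℂ) * (hB.eigenvectorUnitary : Matrix n n ℂ)

theorem eigenOverlap_mem (hA : A.IsHermitian) (hB : B.IsHermitian) :
    eigenOverlap hA hB ∈ unitaryGroup n ℂ :=
  mul_mem (Unitary.star_mem hA.eigenvectorUnitary.2) hB.eigenvectorUnitary.2

theorem rtr_cfc_mul_cfc (hA : A.IsHermitian) (hB : B.IsHermitian) (f g : ℝ → ℝ) :
    rtr (cfc f A * cfc g B) = ∑ i, ∑ j, ‖eigenOverlap hA hB i j‖ ^ 2 *
      (f (hA.eigenvalues i) * g (hB.eigenvalues j)) := by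
  rw [← rtr_diagonal_mul_conj, cfc_eq_eigenvectorUnitary_mul hA,
    cfc_eq_eigenvectorUnitary_mul hB, eigenOverlap, rtr, rtr, star_mul, star_star]
  congr 1
  simp only [mul_assoc]
  rw [trace_mul_comm]
  simp only [mul_assoc]

/-- Klein's inequality. -/
theorem rtr_cfc_mul_cfc_le (hA : A.PosDef) (hB : B.PosDef) {f g h k : ℝ → ℝ}
    (H : ∀ x y, 0 < x → 0 < y → f x * g y ≤ h x + k y) :
    rtr (cfc f A * cfc g B) ≤ rtr (cfc h A) + rtr (cfc k B) := by
  have hU := eigenOverlap_mem hA.1 hB.1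
  rw [rtr_cfc_mul_cfc hA.1 hB.1, rtr_cfc hA.1, rtr_cfc hB.1]
  calc _ ≤ ∑ i, ∑ j, ‖eigenOverlap hA.1 hB.1 i j‖ ^ 2 *
        (h (hA.1.eigenvalues i) + k (hB.1.eigenvalues j)) := by
        gcongr with i _ j _
        exact H _ _ (hA.eigenvalues_pos i) (hB.eigenvalues_pos j)
    _ = _ := by
        simp only [mul_add, Finset.sum_add_distrib]
        congr 1
        · simp only [← Finset.sum_mul, sum_norm_sq_row hU, one_mul]
        · rw [Finset.sum_comm]
          simp only [← Finset.sum_mul, sum_norm_sq_col hU, one_mul]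

theorem rtr_cfc_mul_cfc_mono (hA : A.PosDef) (hB : B.PosDef) {f g h : ℝ → ℝ}
    (hf : ∀ x, 0 < x → 0 ≤ f x) (hgh : ∀ y, 0 < y → g y ≤ h y) :
    rtr (cfc f A * cfc g B) ≤ rtr (cfc f A * cfc h B) := by
  rw [rtr_cfc_mul_cfc hA.1 hB.1, rtr_cfc_mul_cfc hA.1 hB.1]
  gcongr with i _ j _
  · exact hf _ (hA.eigenvalues_pos i)
  · exact hgh _ (hB.eigenvalues_pos j)

theorem mul_log_le {x y : ℝ} (hx : 0 < x) (hy : 0 < y) :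
    x * Real.log y ≤ (x * Real.log x - x) + y := by
  have h := Real.log_le_sub_one_of_pos (div_pos hy hx)
  rw [Real.log_div hy.ne' hx.ne'] at h
  have h2 := mul_le_mul_of_nonneg_left h hx.le
  have h3 : x * (y / x - 1) = y - x := by field_simp
  nlinarith

/-- The Gibbs variational inequality. -/
theorem rtr_mul_mlog_le_s1 (hX : X.PosDef) (hB : B.PosDef) :
    rtr (X * mlog B) ≤ rtr (X * mlog X) - rtr X + rtr B := by
  have h := rtr_cfc_mul_cfc_le hX hB (f := fun x => x) (g := Real.log)
    (h := fun x => x * Real.log x - x) (k := fun x => x) fun x y hx hy => mul_log_le hx hy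
  rw [cfc_sub _ _ X (continuousOn_spectrum X _) (continuousOn_spectrum X _),
    cfc_mul _ _ X (continuousOn_spectrum X _) (continuousOn_spectrum X _),
    cfc_id' ℝ X hX.1.isSelfAdjoint, cfc_id' ℝ B hB.1.isSelfAdjoint, rtr_sub] at h
  exact h

/-- The tangent line inequality for the concave function `A ↦ log det A`. -/
theorem rtr_mlog_le (hA : A.PosDef) (hB : B.PosDef) :
    rtr (mlog A) ≤ rtr (mlog B) + rtr (A * B⁻¹) - Fintype.card n := by
  have h := rtr_cfc_mul_cfc_le hB hA (f := fun y => -y ^ (-1 : ℝ)) (g := fun x => x)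
    (h := fun y => Real.log y - 1) (k := fun x => -Real.log x) fun y x hy hx => by
      have h := Real.log_le_sub_one_of_pos (div_pos hx hy)
      rw [Real.log_div hx.ne' hy.ne'] at h
      rw [Real.rpow_neg_one, neg_mul, inv_mul_eq_div]
      linarith
  rw [cfc_sub _ _ B (continuousOn_spectrum B _) (continuousOn_spectrum B _),
    cfc_const_one ℝ B hB.1.isSelfAdjoint, cfc_neg, cfc_neg, cfc_id' ℝ A hA.1.isSelfAdjoint] at h
  change rtr (-mpow B (-1) * A) ≤ rtr (mlog B - 1) + rtr (-mlog A) at h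
  rw [mpow_neg_one hB, rtr_sub, ← zero_sub (mlog A), rtr_sub, neg_mul, ← zero_sub, rtr_sub,
    rtr, rtr, rtr, rtr, rtr, trace_mul_comm] at h
  simp only [trace_zero, Complex.zero_re, trace_one, Complex.natCast_re] at h
  simp only [rtr]
  linarith

theorem log_det_re (hA : A.PosDef) : Real.log A.det.re = rtr (mlog A) := by
  rw [mlog, rtr_cfc hA.1, hA.1.det_eq_prod_eigenvalues]
  simp only [Complex.coe_algebraMap, ← Complex.ofReal_prod]
  rw [Complex.ofReal_re, Real.log_prod fun i _ => ne_of_gt (hA.eigenvalues_pos i)]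

/-- Midpoint concavity of `log det`. -/
theorem log_det_re_add_log_det_re_le {P K : Matrix n n ℂ} (hP : P.PosDef)
    (h₁ : (P + K).PosDef) (h₂ : (P - K).PosDef) :
    Real.log (P + K).det.re + Real.log (P - K).det.re ≤ 2 * Real.log P.det.re := by
  rw [log_det_re hP, log_det_re h₁, log_det_re h₂]
  have e₁ := rtr_mlog_le h₁ hP
  have e₂ := rtr_mlog_le h₂ hP
  rw [add_mul, rtr_add] at e₁
  rw [sub_mul, rtr_sub] at e₂
  have e : rtr (P * P⁻¹) = Fintype.card n := by
    rw [mul_nonsing_inv _ ((isUnit_iff_isUnit_det P).1 hP.isUnit), rtr, trace_one,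
      Complex.natCast_re]
  linarith

end FunctionalCalculus

section LogIntegral

theorem integrableOn_log_one_add_mul_rpow {r : ℝ} (h0 : 0 < r) (h1 : r < 1) :
    IntegrableOn (fun t : ℝ => Real.log (1 + t) * t ^ (-r - 1)) (Set.Ioi 0) := by
  have hmeas : Measurable fun t : ℝ => Real.log (1 + t) * t ^ (-r - 1) := by fun_prop
  rw [← Set.Ioc_union_Ioi_eq_Ioi zero_le_one]
  refine IntegrableOn.union ?_ ?_
  · have h : IntegrableOn (fun t : ℝ => t ^ (-r)) (Set.Ioc 0 1) :=
      (intervalIntegrable_iff_integrableOn_Ioc_of_le zero_le_one).1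
        (intervalIntegral.intervalIntegrable_rpow' (by linarith))
    refine h.mono' hmeas.aestronglyMeasurable ?_
    filter_upwards [ae_restrict_mem measurableSet_Ioc] with t ht
    have ht0 : 0 < t := ht.1
    have hlog : 0 ≤ Real.log (1 + t) := Real.log_nonneg (by linarith)
    rw [Real.norm_of_nonneg (mul_nonneg hlog (Real.rpow_nonneg ht0.le _))]
    calc Real.log (1 + t) * t ^ (-r - 1) ≤ t * t ^ (-r - 1) := by
          gcongr
          linarith [Real.log_le_sub_one_of_pos (show 0 < 1 + t by linarith)]
      _ = t ^ (-r) := by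
          rw [Real.rpow_sub_one ht0.ne']
          field_simp
  · have h : IntegrableOn (fun t : ℝ => 2 * (2 / r) * t ^ (-(r / 2) - 1)) (Set.Ioi 1) :=
      (integrableOn_Ioi_rpow_of_lt (by linarith) zero_lt_one).const_mul _
    refine h.mono' hmeas.aestronglyMeasurable ?_
    filter_upwards [ae_restrict_mem measurableSet_Ioi] with t ht
    have ht1 : 1 < t := ht
    have ht0 : 0 < t := by linarith
    have hlog : 0 ≤ Real.log (1 + t) := Real.log_nonneg (by linarith)
    rw [Real.norm_of_nonneg (mul_nonneg hlog (Real.rpow_nonneg ht0.le _))]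
    have h2 : Real.log (1 + t) ≤ 2 * (2 / r) * t ^ (r / 2) := by
      have e1 : Real.log (1 + t) ≤ Real.log (t ^ (2 : ℝ) * 2) := by
        apply Real.log_le_log (by linarith)
        rw [Real.rpow_two]
        nlinarith
      have e2 := Real.log_le_rpow_div (show 0 ≤ 1 + t by linarith) (half_pos h0)
      have e3 : (1 + t) ^ (r / 2) ≤ (2 * t) ^ (r / 2) :=
        Real.rpow_le_rpow (by linarith) (by linarith) (by linarith)
      have e4 : (2 : ℝ) ^ (r / 2) ≤ 2 := by
        conv_rhs => rw [← Real.rpow_one 2]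
        exact Real.rpow_le_rpow_of_exponent_le one_le_two (by linarith)
      rw [Real.mul_rpow zero_le_two ht0.le] at e3
      calc _ ≤ (1 + t) ^ (r / 2) / (r / 2) := e2
        _ ≤ 2 * t ^ (r / 2) / (r / 2) := by
            gcongr
            exact e3.trans (by gcongr)
        _ = _ := by field_simp
    calc _ ≤ 2 * (2 / r) * t ^ (r / 2) * t ^ (-r - 1) := by gcongr
      _ = _ := by
        rw [mul_assoc, ← Real.rpow_add ht0]
        ring_nf

theorem integral_log_one_add_mul_rpow_pos {r : ℝ} (h0 : 0 < r) (h1 : r < 1) :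
    0 < ∫ t in Set.Ioi (0 : ℝ), Real.log (1 + t) * t ^ (-r - 1) := by
  have hpos : ∀ t ∈ Set.Ioi (0 : ℝ), 0 < Real.log (1 + t) * t ^ (-r - 1) := fun t ht =>
    mul_pos (Real.log_pos (by linarith [Set.mem_Ioi.1 ht])) (Real.rpow_pos_of_pos ht _)
  have hs : (Function.support fun t : ℝ => Real.log (1 + t) * t ^ (-r - 1)) ∩ Set.Ioi 0 =
      Set.Ioi 0 :=
    Set.inter_eq_right.2 fun t ht => (hpos t ht).ne'
  rw [setIntegral_pos_iff_support_of_nonneg_ae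
    (by filter_upwards [ae_restrict_mem measurableSet_Ioi] with t ht using (hpos t ht).le)
    (integrableOn_log_one_add_mul_rpow h0 h1),
    hs]
  simp

theorem log_one_add_mul_mul_rpow {r t x : ℝ} (hx : 0 < x) (ht : 0 < t) :
    Real.log (1 + t * x) * t ^ (-r - 1) =
      x ^ (r + 1) * (Real.log (1 + x * t) * (x * t) ^ (-r - 1)) := by
  rw [Real.mul_rpow hx.le ht.le, mul_comm x t]
  have : x ^ (r + 1) * x ^ (-r - 1) = 1 := by
    rw [← Real.rpow_add hx]
    ring_nf
    exact Real.rpow_zero x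
  linear_combination (-Real.log (1 + t * x) * t ^ (-r - 1)) * this

theorem integrableOn_log_one_add_mul_mul_rpow {r x : ℝ} (h0 : 0 < r) (h1 : r < 1) (hx : 0 < x) :
    IntegrableOn (fun t : ℝ => Real.log (1 + t * x) * t ^ (-r - 1)) (Set.Ioi 0) := by
  have h := ((integrableOn_Ioi_comp_mul_left_iff
    (fun t : ℝ => Real.log (1 + t) * t ^ (-r - 1)) 0 hx).2
    (by rw [mul_zero]; exact integrableOn_log_one_add_mul_rpow h0 h1)).const_mul (x ^ (r + 1))
  exact IntegrableOn.congr_fun h (fun t ht => (log_one_add_mul_mul_rpow hx ht).symm)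
    measurableSet_Ioi

theorem integral_log_one_add_mul_mul_rpow {r x : ℝ} (hx : 0 < x) :
    ∫ t in Set.Ioi (0 : ℝ), Real.log (1 + t * x) * t ^ (-r - 1) =
      x ^ r * ∫ t in Set.Ioi (0 : ℝ), Real.log (1 + t) * t ^ (-r - 1) := by
  rw [setIntegral_congr_fun measurableSet_Ioi fun t ht => log_one_add_mul_mul_rpow hx ht,
    integral_const_mul,
    integral_comp_mul_left_Ioi (fun t : ℝ => Real.log (1 + t) * t ^ (-r - 1)) 0 hx, mul_zero,
    smul_eq_mul, ← mul_assoc, Real.rpow_add_one hx.ne', mul_assoc (x ^ r), mul_inv_cancel₀ hx.ne',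
    mul_one]

theorem sum_rpow_le_of_sum_log_le {ι : Type*} [Fintype ι] {x y : ι → ℝ} {r : ℝ}
    (h0 : 0 < r) (h1 : r < 1) (hx : ∀ i, 0 < x i) (hy : ∀ i, 0 < y i)
    (h : ∀ t, 0 < t → ∑ i, Real.log (1 + t * x i) ≤ ∑ i, Real.log (1 + t * y i)) :
    ∑ i, x i ^ r ≤ ∑ i, y i ^ r := by
  have key : ∀ z : ι → ℝ, (∀ i, 0 < z i) →
      ∫ t in Set.Ioi (0 : ℝ), ∑ i, Real.log (1 + t * z i) * t ^ (-r - 1) =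
        (∑ i, z i ^ r) * ∫ t in Set.Ioi (0 : ℝ), Real.log (1 + t) * t ^ (-r - 1) := by
    intro z hz
    rw [integral_finsetSum _ fun i _ => integrableOn_log_one_add_mul_mul_rpow h0 h1 (hz i),
      Finset.sum_mul]
    exact Finset.sum_congr rfl fun i _ => integral_log_one_add_mul_mul_rpow (hz i)
  refine le_of_mul_le_mul_right ?_ (integral_log_one_add_mul_rpow_pos h0 h1)
  rw [← key x hx, ← key y hy]
  refine setIntegral_mono_on
    (integrable_finsetSum _ fun i _ => integrableOn_log_one_add_mul_mul_rpow h0 h1 (hx i))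
    (integrable_finsetSum _ fun i _ => integrableOn_log_one_add_mul_mul_rpow h0 h1 (hy i))
    measurableSet_Ioi fun t ht => ?_
  rw [← Finset.sum_mul, ← Finset.sum_mul]
  exact mul_le_mul_of_nonneg_right (h t ht) (Real.rpow_nonneg (le_of_lt ht) _)

end LogIntegral

section ArakiLiebThirring

variable {n : Type*} [Fintype n] [DecidableEq n] {a c : Matrix n n ℂ}

theorem det_one_add_smul {M : Matrix n n ℂ} (hM : M.IsHermitian) (z : ℂ) :
    (1 + z • M).det = ∏ i, (1 + z * hM.eigenvalues i) := by
  conv_lhs => rw [eq_eigenvectorUnitary_mul hM]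
  rw [mul_assoc, ← smul_mul_assoc, det_one_add_mul_comm, mul_smul_comm, mul_assoc,
    Unitary.coe_star_mul_self, mul_one, ← diagonal_one, ← diagonal_smul, diagonal_add,
    det_diagonal]
  rfl

theorem log_det_one_add_smul {P : Matrix n n ℂ} (hP : P.PosDef) {t : ℝ} (ht : 0 < t) :
    Real.log (1 + (t : ℂ) • P).det.re = ∑ i, Real.log (1 + t * hP.1.eigenvalues i) := by
  have h : (1 + (t : ℂ) • P).det = ((∏ i, (1 + t * hP.1.eigenvalues i) : ℝ) : ℂ) := by
    rw [det_one_add_smul hP.1]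
    push_cast
    rfl
  rw [h, Complex.ofReal_re, Real.log_prod fun i _ => ?_]
  have := hP.eigenvalues_pos i
  positivity

/-- `det ((1 + i s T)ᴴ (1 + i s T))` when `T` is similar to a Hermitian matrix. -/
theorem det_conjTranspose_mul_self_one_add {T M : Matrix n n ℂ} (hM : M.IsHermitian)
    (hT : ∀ z : ℂ, (1 + z • T).det = (1 + z • M).det) (s : ℝ) :
    ((1 + (Complex.I * s) • T)ᴴ * (1 + (Complex.I * s) • T)).det =
      ((∏ i, (1 + s ^ 2 * hM.eigenvalues i ^ 2) : ℝ) : ℂ) := by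
  rw [det_mul, det_conjTranspose, hT, det_one_add_smul hM, star_prod, ← Finset.prod_mul_distrib]
  push_cast
  refine Finset.prod_congr rfl fun i _ => ?_
  simp only [Complex.star_def, map_add, map_mul, map_one, Complex.conj_I, Complex.conj_ofReal]
  linear_combination (-(s : ℂ) ^ 2 * hM.eigenvalues i ^ 2) * Complex.I_sq

theorem posDef_conjTranspose_mul_self_one_add {T M : Matrix n n ℂ} (hM : M.IsHermitian)
    (hT : ∀ z : ℂ, (1 + z • T).det = (1 + z • M).det) (s : ℝ) :
    ((1 + (Complex.I * s) • T)ᴴ * (1 + (Complex.I * s) • T)).PosDef := by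
  refine PosDef.conjTranspose_mul_self _ (mulVec_injective_of_isUnit ?_)
  rw [isUnit_iff_isUnit_det, isUnit_iff_ne_zero]
  intro h0
  have h := det_conjTranspose_mul_self_one_add hM hT s
  rw [det_mul, h0, mul_zero] at h
  have hpos : 0 < ∏ i, (1 + s ^ 2 * hM.eigenvalues i ^ 2) :=
    Finset.prod_pos fun i _ => by positivity
  exact hpos.ne (by exact_mod_cast h)

theorem sum_log_one_add_sq_le {T M P : Matrix n n ℂ} (hM : M.IsHermitian) (hP : P.PosDef)
    (hT : ∀ z : ℂ, (1 + z • T).det = (1 + z • M).det) (hPT : P = Tᴴ * T) {t : ℝ} (ht : 0 < t) :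
    ∑ i, Real.log (1 + t * hM.eigenvalues i ^ 2) ≤
      ∑ i, Real.log (1 + t * hP.1.eigenvalues i) := by
  set s := Real.sqrt t with hs
  have hst : s ^ 2 = t := Real.sq_sqrt ht.le
  have hst' : (s : ℂ) ^ 2 = t := by exact_mod_cast hst
  set K : Matrix n n ℂ := (Complex.I * s) • (T - Tᴴ) with hK
  have e : ∀ u : ℝ, u ^ 2 = t → (1 + (Complex.I * u) • T)ᴴ * (1 + (Complex.I * u) • T) =
      (1 + (t : ℂ) • P) + (Complex.I * u) • (T - Tᴴ) := by
    intro u hu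
    have hu' : (u : ℂ) ^ 2 = t := by exact_mod_cast hu
    have hconj : star (Complex.I * u) = -(Complex.I * u) := by
      simp
    rw [hPT, conjTranspose_add, conjTranspose_one, conjTranspose_smul, hconj, ← hu']
    simp only [add_mul, mul_add, one_mul, mul_one, smul_mul_smul_comm, smul_sub, neg_smul,
      neg_mul]
    have : (Complex.I * u) * (Complex.I * u) = -(u : ℂ) ^ 2 := by
      linear_combination (u : ℂ) ^ 2 * Complex.I_sq
    rw [this]
    simp only [neg_smul, neg_neg]
    abel
  have e₁ := e s hst
  have e₂ := e (-s) (by rw [neg_sq, hst])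
  have hK₂ : (Complex.I * ((-s : ℝ) : ℂ)) • (T - Tᴴ) = -K := by
    rw [hK, ← neg_smul]
    push_cast
    ring_nf
  rw [hK₂, ← sub_eq_add_neg] at e₂
  rw [← hK] at e₁
  have p₁ := posDef_conjTranspose_mul_self_one_add hM hT s
  have p₂ := posDef_conjTranspose_mul_self_one_add hM hT (-s)
  have d₁ := det_conjTranspose_mul_self_one_add hM hT s
  have d₂ := det_conjTranspose_mul_self_one_add hM hT (-s)
  rw [e₁] at p₁ d₁
  rw [e₂] at p₂ d₂
  have hQ : (1 + (t : ℂ) • P).PosDef :=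
    PosDef.one.add_posSemidef (hP.posSemidef.smul (by exact_mod_cast ht.le))
  have hmain := log_det_re_add_log_det_re_le hQ p₁ p₂
  rw [d₁, d₂, neg_sq, hst, Complex.ofReal_re, log_det_one_add_smul hP ht,
    Real.log_prod fun i _ => by positivity] at hmain
  linarith

theorem posDef_sq_conj (ha : a.PosDef) (hc : c.PosDef) : (c * c * (a * a) * (c * c)).PosDef := by
  have h1 := posDef_conj (posDef_conj PosDef.one ha) (posDef_conj PosDef.one hc)
  simpa using h1

theorem sum_eigenvalues_rpow_le_of_lt_one (ha : a.PosDef) (hc : c.PosDef) {r : ℝ}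
    (h0 : 0 < r) (h1 : r < 1) :
    ∑ i, ((posDef_conj ha hc).1.eigenvalues i ^ 2) ^ r ≤
      ∑ i, (posDef_sq_conj ha hc).1.eigenvalues i ^ r := by
  refine sum_rpow_le_of_sum_log_le h0 h1
    (fun i => pow_pos ((posDef_conj ha hc).eigenvalues_pos i) 2)
    (fun i => (posDef_sq_conj ha hc).eigenvalues_pos i) fun t ht =>
    sum_log_one_add_sq_le (T := a * c * c) (posDef_conj ha hc).1 (posDef_sq_conj ha hc)
      (fun z => ?_) ?_ ht
  · rw [← smul_mul_assoc, det_one_add_mul_comm, mul_smul_comm, mul_assoc c]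
  · rw [conjTranspose_mul, conjTranspose_mul, ha.1.eq, hc.1.eq]
    simp only [mul_assoc]

end ArakiLiebThirring

section Weyl

theorem norm_sq_diag_le {n : Type*} [Fintype n] (B : Matrix n n ℂ) (j : n) :
    ‖B j j‖ ^ 2 ≤ ((Bᴴ * B) j j).re := by
  rw [mul_apply, Complex.re_sum]
  have : ∀ i, (Bᴴ j i * B i j).re = ‖B i j‖ ^ 2 := fun i => by
    rw [conjTranspose_apply, Complex.star_def, Complex.conj_mul', ← Complex.ofReal_pow,
      Complex.ofReal_re]
  simp only [this]
  exact Finset.single_le_sum (f := fun i => ‖B i j‖ ^ 2) (fun i _ => sq_nonneg _)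
    (Finset.mem_univ j)

variable {n : Type*} [Fintype n] [DecidableEq n] {a c : Matrix n n ℂ}

/-- QR decomposition of a square matrix, with respect to an enumeration of the index type. -/
theorem exists_unitary_mul_blockTriangular {k : ℕ} (e : n ≃ Fin k) (S : Matrix n n ℂ) :
    ∃ Q R : Matrix n n ℂ, Q ∈ unitaryGroup n ℂ ∧ S = Q * R ∧ R.BlockTriangular e := by
  let v : Fin k → EuclideanSpace ℂ n := fun j => WithLp.toLp 2 (fun i => S i (e.symm j))
  have hk : Module.finrank ℂ (EuclideanSpace ℂ n) = Fintype.card (Fin k) := by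
    rw [finrank_euclideanSpace, Fintype.card_congr e]
  let b := InnerProductSpace.gramSchmidtOrthonormalBasis (𝕜 := ℂ) hk v
  let Q : Matrix n n ℂ := of fun i j => b (e j) i
  have hQ : star Q * Q = 1 := by
    ext i j
    have h := orthonormal_iff_ite.1 b.orthonormal (e i) (e j)
    rw [one_apply]
    simp only [EmbeddingLike.apply_eq_iff_eq] at h
    rw [← h, mul_apply, PiLp.inner_apply]
    refine Finset.sum_congr rfl fun k _ => ?_
    simp [Q, star_apply, mul_comm]
  refine ⟨Q, star Q * S, mem_unitaryGroup_iff'.2 hQ, ?_, fun i j hij => ?_⟩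
  · rw [← mul_assoc, mul_eq_one_comm.1 hQ, one_mul]
  · have h := InnerProductSpace.gramSchmidtOrthonormalBasis_inv_triangular (𝕜 := ℂ) hk v hij
    rw [← h, mul_apply, PiLp.inner_apply]
    refine Finset.sum_congr rfl fun k _ => ?_
    simp [Q, v, b, star_apply, mul_comm]

theorem diag_mul_diagonal_mul_of_blockTriangular {k : ℕ} (e : n ≃ Fin k) {R R' : Matrix n n ℂ}
    (hR : R.BlockTriangular e) (hR' : R'.BlockTriangular e) (h : R * R' = 1) (d : n → ℂ) (j : n) :
    (R * diagonal d * R') j j = d j := by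
  have key : ∀ d : n → ℂ, (R * diagonal d * R') j j = R j j * d j * R' j j := by
    intro d
    rw [mul_apply, Finset.sum_eq_single_of_mem j (Finset.mem_univ j) fun i _ hij => ?_,
      mul_diagonal]
    rw [mul_diagonal]
    rcases lt_or_gt_of_ne (fun h => hij (e.injective h)) with h | h
    · rw [hR h]
      ring
    · rw [hR' h]
      ring
  have h1 := key 1
  rw [show diagonal (1 : n → ℂ) = 1 from diagonal_one, mul_one, h, one_apply_eq,
    Pi.one_apply] at h1
  rw [key]
  linear_combination (-d j) * h1

/-- Unitary triangularization: a diagonalizable matrix is unitarily similar to a matrix with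
its eigenvalues on the diagonal. -/
theorem exists_unitary_conj_diag {T S : Matrix n n ℂ} (hS : IsUnit S) {d : n → ℂ}
    (h : T * S = S * diagonal d) :
    ∃ Q ∈ unitaryGroup n ℂ, ∀ j, (star Q * T * Q) j j = d j := by
  obtain ⟨Q, R, hQ, hSQ, hR⟩ := exists_unitary_mul_blockTriangular (Fintype.equivFin n) S
  have hQ' := mem_unitaryGroup_iff'.1 hQ
  have hRu : IsUnit R := by
    have : R = star Q * S := by rw [hSQ, ← mul_assoc, hQ', one_mul]
    rw [this]
    exact (IsUnit.of_mul_eq_one _ hQ').mul hS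
  have hRd := (isUnit_iff_isUnit_det R).1 hRu
  have := hRu.invertible
  refine ⟨Q, hQ, fun j => ?_⟩
  rw [← diag_mul_diagonal_mul_of_blockTriangular (Fintype.equivFin n) hR
    (blockTriangular_inv_of_blockTriangular hR) (mul_nonsing_inv R hRd) d j]
  have hQR : star Q * T * Q = R * diagonal d * R⁻¹ := by
    calc star Q * T * Q = star Q * (T * S) * R⁻¹ := by
          simp only [hSQ, mul_assoc, mul_nonsing_inv R hRd, mul_one]
      _ = star Q * Q * R * diagonal d * R⁻¹ := by
          rw [h, hSQ]
          simp only [mul_assoc]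
      _ = _ := by rw [hQ', one_mul]
  rw [hQR]

/-- The Schur–Horn description of the diagonal of a unitary conjugate. -/
theorem re_diag_unitary_conj {P Q : Matrix n n ℂ} (hP : P.IsHermitian) (j : n) :
    ((star Q * P * Q) j j).re =
      ∑ i, ‖(star (hP.eigenvectorUnitary : Matrix n n ℂ) * Q) i j‖ ^ 2 * hP.eigenvalues i := by
  conv_lhs => rw [eq_eigenvectorUnitary_mul hP]
  set W := star (hP.eigenvectorUnitary : Matrix n n ℂ) * Q with hW
  have : star Q * ((hP.eigenvectorUnitary : Matrix n n ℂ) *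
      diagonal (fun i => (hP.eigenvalues i : ℂ)) * star (hP.eigenvectorUnitary : Matrix n n ℂ)) *
      Q = star W * diagonal (fun i => (hP.eigenvalues i : ℂ)) * W := by
    rw [hW, star_mul, star_star]
    simp only [mul_assoc]
  rw [this, mul_apply, Complex.re_sum]
  refine Finset.sum_congr rfl fun i _ => ?_
  rw [mul_diagonal, star_apply, Complex.star_def, mul_right_comm, Complex.conj_mul',
    ← Complex.ofReal_pow, ← Complex.ofReal_mul, Complex.ofReal_re]

/-- Weyl's majorant inequality, in the form of power sums. -/
theorem sum_sq_rpow_le_of_one_le {T S P : Matrix n n ℂ} (hS : IsUnit S) {d : n → ℝ}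
    (h : T * S = S * diagonal (fun i => (d i : ℂ))) (hP : P.PosDef) (hPT : P = Tᴴ * T)
    {r : ℝ} (hr : 1 ≤ r) :
    ∑ i, (d i ^ 2) ^ r ≤ ∑ i, hP.1.eigenvalues i ^ r := by
  obtain ⟨Q, hQ, hd⟩ := exists_unitary_conj_diag hS h
  set W := star (hP.1.eigenvectorUnitary : Matrix n n ℂ) * Q
  have hW : W ∈ unitaryGroup n ℂ := mul_mem (Unitary.star_mem hP.1.eigenvectorUnitary.2) hQ
  have hle : ∀ j, d j ^ 2 ≤ ∑ i, ‖W i j‖ ^ 2 * hP.1.eigenvalues i := by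
    intro j
    have h1 := norm_sq_diag_le (star Q * T * Q) j
    rw [hd j, Complex.norm_real, Real.norm_eq_abs, sq_abs] at h1
    have h2 : (star Q * T * Q)ᴴ * (star Q * T * Q) = star Q * P * Q := by
      rw [hPT, ← star_eq_conjTranspose, ← star_eq_conjTranspose, star_mul, star_mul, star_star]
      calc star Q * (star T * Q) * (star Q * T * Q)
          = star Q * star T * (Q * star Q) * T * Q := by simp only [mul_assoc]
        _ = _ := by rw [mem_unitaryGroup_iff.1 hQ, mul_one]; simp only [mul_assoc]
    rwa [h2, re_diag_unitary_conj hP.1] at h1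
  calc ∑ j, (d j ^ 2) ^ r
      ≤ ∑ j, ∑ i, ‖W i j‖ ^ 2 * hP.1.eigenvalues i ^ r := by
        refine Finset.sum_le_sum fun j _ => ?_
        refine (Real.rpow_le_rpow (sq_nonneg _) (hle j) (by linarith)).trans ?_
        exact Real.rpow_arith_mean_le_arith_mean_rpow _ _ _ (fun i _ => sq_nonneg _)
          (sum_norm_sq_col hW j) (fun i _ => (hP.eigenvalues_pos i).le) hr
    _ = _ := by
        rw [Finset.sum_comm]
        simp only [← Finset.sum_mul, sum_norm_sq_row hW, one_mul]

theorem sum_eigenvalues_rpow_le_of_one_le (ha : a.PosDef) (hc : c.PosDef) {r : ℝ} (hr : 1 ≤ r) :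
    ∑ i, ((posDef_conj ha hc).1.eigenvalues i ^ 2) ^ r ≤
      ∑ i, (posDef_sq_conj ha hc).1.eigenvalues i ^ r := by
  have hM := (posDef_conj ha hc).1
  have hU := hM.eigenvectorUnitary.2
  refine sum_sq_rpow_le_of_one_le (T := a * c * c)
    (S := a * c * (hM.eigenvectorUnitary : Matrix n n ℂ)) ?_ ?_ (posDef_sq_conj ha hc) ?_ hr
  · exact (ha.isUnit.mul hc.isUnit).mul (IsUnit.of_mul_eq_one _ (mem_unitaryGroup_iff.1 hU))
  · have h := eq_eigenvectorUnitary_mul hM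
    calc a * c * c * (a * c * (hM.eigenvectorUnitary : Matrix n n ℂ))
        = a * c * ((c * a * c) * (hM.eigenvectorUnitary : Matrix n n ℂ)) := by
          simp only [mul_assoc]
      _ = _ := by
          conv_lhs => enter [2, 1]; rw [h]
          rw [mul_assoc _ (star _), mem_unitaryGroup_iff'.1 hU, mul_one]
          simp only [mul_assoc]
  · rw [conjTranspose_mul, conjTranspose_mul, ha.1.eq, hc.1.eq]
    simp only [mul_assoc]

/-- The Araki–Lieb–Thirring inequality for doubled exponents. -/
theorem rtr_mpow_conj_le (ha : a.PosDef) (hc : c.PosDef) {r : ℝ} (hr : 0 < r) :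
    rtr (mpow (c * a * c) (2 * r)) ≤ rtr (mpow (c * c * (a * a) * (c * c)) r) := by
  rw [mpow, mpow, rtr_cfc (posDef_conj ha hc).1, rtr_cfc (posDef_sq_conj ha hc).1]
  have : ∀ i, (posDef_conj ha hc).1.eigenvalues i ^ (2 * r) =
      ((posDef_conj ha hc).1.eigenvalues i ^ 2) ^ r := fun i => by
    rw [Real.rpow_mul ((posDef_conj ha hc).eigenvalues_pos i).le, Real.rpow_two]
  simp only [this]
  rcases lt_or_ge r 1 with h1 | h1
  · exact sum_eigenvalues_rpow_le_of_lt_one ha hc hr h1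
  · exact sum_eigenvalues_rpow_le_of_one_le ha hc h1

end Weyl

section GoldenThompson

variable {n : Type*} [Fintype n] [DecidableEq n] {A X F Y : Matrix n n ℂ}

/-- The interpolating family `Y^(-q/2) F^(q/p) Y^(-q/2)`. -/
noncomputable def powConj (F Y : Matrix n n ℂ) (p q : ℝ) : Matrix n n ℂ :=
  mpow Y (-q / 2) * mpow F (q / p) * mpow Y (-q / 2)

theorem posDef_powConj (hF : F.PosDef) (hY : Y.PosDef) (p q : ℝ) : (powConj F Y p q).PosDef :=
  posDef_conj (posDef_mpow hF _) (posDef_mpow hY _)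

theorem rtr_mpow_powConj_half_le (hF : F.PosDef) (hY : Y.PosDef) {p q : ℝ} (hq : 0 < q) :
    rtr (mpow (powConj F Y p (q / 2)) (1 / (q / 2))) ≤ rtr (mpow (powConj F Y p q) (1 / q)) := by
  have h := rtr_mpow_conj_le (posDef_mpow hF (q / 2 / p)) (posDef_mpow hY (-(q / 2) / 2))
    (one_div_pos.2 hq)
  rw [mpow_mul_mpow hF, mpow_mul_mpow hY] at h
  convert h using 2
  · rw [powConj]
    congr 1
    field_simp
  · rw [powConj]
    ring_nf

theorem rtr_mpow_powConj_le (hF : F.PosDef) (hY : Y.PosDef) {p : ℝ} (hp : 0 < p) (k : ℕ) :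
    rtr (mpow (powConj F Y p (p / 2 ^ k)) (1 / (p / 2 ^ k))) ≤
      rtr (mpow (powConj F Y p p) (1 / p)) := by
  induction k with
  | zero => simp
  | succ k ih =>
    refine le_trans ?_ ih
    have h := rtr_mpow_powConj_half_le hF hY (p := p) (show 0 < p / 2 ^ k by positivity)
    rwa [div_div, ← pow_succ] at h

theorem inv_powConj (hF : F.PosDef) (hY : Y.PosDef) (p q : ℝ) :
    (powConj F Y p q)⁻¹ = mpow Y (q / 2) * mpow F (-q / p) * mpow Y (q / 2) := by
  refine inv_eq_left_inv ?_
  have e1 : mpow Y (q / 2) * mpow Y (-q / 2) = 1 := by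
    rw [mpow_mul_mpow hY, ← mpow_zero hY]
    ring_nf
  have e2 : mpow F (-q / p) * mpow F (q / p) = 1 := by
    rw [mpow_mul_mpow hF, ← mpow_zero hF]
    ring_nf
  calc _ = mpow Y (q / 2) * (mpow F (-q / p) * (mpow Y (q / 2) * mpow Y (-q / 2)) *
        mpow F (q / p)) * mpow Y (-q / 2) := by
        rw [powConj]
        simp only [mul_assoc]
    _ = 1 := by rw [e1, mul_one, e2, mul_one, e1]

theorem rtr_mul_one_sub_inv_le (hX : X.PosDef) (hA : A.PosDef) :
    rtr (X * (1 - A⁻¹)) ≤ rtr (X * mlog A) := by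
  have h := rtr_cfc_mul_cfc_mono hX hA (f := fun x => x) (g := fun y => 1 - y ^ (-1 : ℝ))
    (h := Real.log) (fun _ hx => hx.le) fun y hy => by
      rw [Real.rpow_neg_one]
      exact Real.one_sub_inv_le_log_of_pos hy
  rw [cfc_sub _ _ A (continuousOn_spectrum A _) (continuousOn_spectrum A _),
    cfc_const_one ℝ A hA.1.isSelfAdjoint, cfc_id' ℝ X hX.1.isSelfAdjoint] at h
  rw [← mpow_neg_one hA]
  exact h

theorem rtr_mul_one_sub_inv_powConj_le (hX : X.PosDef) (hF : F.PosDef) (hY : Y.PosDef) {p : ℝ}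
    (hp : 0 < p) (htr : rtr (mpow (powConj F Y p p) (1 / p)) = rtr X) (k : ℕ) :
    rtr (X * ((1 / (p / 2 ^ k)) • (1 - (powConj F Y p (p / 2 ^ k))⁻¹))) ≤ rtr (X * mlog X) := by
  set q := p / 2 ^ k
  have hq : 0 < q := by positivity
  have hΦ := posDef_powConj hF hY p q
  have h1 := rtr_mul_mlog_le_s1 hX (posDef_mpow hΦ (1 / q))
  have h2 : rtr (mpow (powConj F Y p q) (1 / q)) ≤ rtr X :=
    (rtr_mpow_powConj_le hF hY hp k).trans_eq htr
  have h3 := mul_le_mul_of_nonneg_left (rtr_mul_one_sub_inv_le hX hΦ) (one_div_pos.2 hq).le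
  rw [mlog_mpow hΦ, mul_smul_comm, rtr_smul] at h1
  rw [mul_smul_comm, rtr_smul]
  linarith

/-! ### Derivative of matrix powers at exponent zero -/

theorem tendsto_cfc (hA : A.IsHermitian) {ι : Type*} {l : Filter ι} {f : ι → ℝ → ℝ} {g : ℝ → ℝ}
    (h : ∀ x ∈ spectrum ℝ A, Tendsto (fun q => f q x) l (𝓝 (g x))) :
    Tendsto (fun q => cfc (f q) A) l (𝓝 (cfc g A)) := by
  simp only [cfc_eq_eigenvectorUnitary_mul hA]
  have hd : Tendsto (fun q => diagonal fun i => ((f q (hA.eigenvalues i) : ℝ) : ℂ)) l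
      (𝓝 (diagonal fun i => ((g (hA.eigenvalues i) : ℝ) : ℂ))) :=
    ((continuous_id.matrix_diagonal).tendsto _).comp (tendsto_pi_nhds.2 fun i =>
      (Complex.continuous_ofReal.tendsto _).comp (h _ (hA.eigenvalues_mem_spectrum_real i)))
  exact (hd.const_mul _).mul_const _

theorem tendsto_mpow_mul (hA : A.PosDef) (s : ℝ) {l : Filter ℝ} (hl : Tendsto id l (𝓝 0)) :
    Tendsto (fun q => mpow A (s * q)) l (𝓝 1) := by
  rw [← mpow_zero hA]
  refine tendsto_cfc hA.1 fun x hx => ?_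
  have h : Continuous fun q : ℝ => x ^ (s * q) :=
    (Real.continuous_const_rpow (pos_of_mem_spectrum hA hx).ne').comp (continuous_const_mul s)
  simpa using (h.tendsto 0).comp hl

theorem tendsto_smul_one_sub_mpow (hA : A.PosDef) (s : ℝ) :
    Tendsto (fun q : ℝ => (1 / q) • (1 - mpow A (s * q))) (𝓝[≠] 0) (𝓝 (-s • mlog A)) := by
  have e : ∀ q : ℝ, (1 / q) • (1 - mpow A (s * q)) =
      cfc (fun x : ℝ => (1 / q) * (1 - x ^ (s * q))) A := fun q => by
    rw [cfc_const_mul _ _ A (continuousOn_spectrum A _),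
      cfc_sub _ _ A (continuousOn_spectrum A _) (continuousOn_spectrum A _),
      cfc_const_one ℝ A hA.1.isSelfAdjoint, mpow]
  simp only [e]
  rw [mlog, ← cfc_const_mul _ _ A (continuousOn_spectrum A _)]
  refine tendsto_cfc hA.1 fun x hx => ?_
  have hx0 := pos_of_mem_spectrum hA hx
  have hd : HasDerivAt (fun q : ℝ => x ^ (s * q)) (s * Real.log x) 0 := by
    have h := ((hasDerivAt_id (0 : ℝ)).const_mul s).const_rpow hx0
    simpa [mul_comm] using h
  have ht := hd.tendsto_slope.neg
  rw [← neg_mul] at ht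
  refine ht.congr fun q => ?_
  rw [slope_def_field]
  simp only [mul_zero, Real.rpow_zero, sub_zero]
  ring

theorem tendsto_smul_one_sub_inv_powConj (hF : F.PosDef) (hY : Y.PosDef) (p : ℝ) :
    Tendsto (fun q : ℝ => (1 / q) • (1 - (powConj F Y p q)⁻¹)) (𝓝[≠] 0)
      (𝓝 ((1 / p) • mlog F - mlog Y)) := by
  have hid : Tendsto (id : ℝ → ℝ) (𝓝[≠] 0) (𝓝 0) := nhdsWithin_le_nhds
  have u := tendsto_mpow_mul hY (1 / 2) hid
  have f := tendsto_mpow_mul hF (-1 / p) hid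
  have du := tendsto_smul_one_sub_mpow hY (1 / 2)
  have df := tendsto_smul_one_sub_mpow hF (-1 / p)
  have h := (du.add (u.mul df)).add ((u.mul f).mul du)
  have hlim : -(1 / 2 : ℝ) • mlog Y + 1 * (-(-1 / p) • mlog F) + 1 * 1 * (-(1 / 2 : ℝ) • mlog Y) =
      (1 / p) • mlog F - mlog Y := by
    rw [one_mul, one_mul, one_mul]
    module
  rw [hlim] at h
  refine h.congr fun q => ?_
  rw [inv_powConj hF hY, show q / 2 = 1 / 2 * q by ring, show -q / p = -1 / p * q by ring]
  simp only [mul_smul_comm, ← smul_add]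
  congr 1
  noncomm_ring

theorem rtr_mul_sub_mlog_le (hX : X.PosDef) (hF : F.PosDef) (hY : Y.PosDef) {p : ℝ}
    (hp : 0 < p) (htr : rtr (mpow (powConj F Y p p) (1 / p)) = rtr X) :
    rtr (X * ((1 / p) • mlog F - mlog Y)) ≤ rtr (X * mlog X) := by
  have hcont : Continuous fun B : Matrix n n ℂ => rtr (X * B) :=
    Complex.continuous_re.comp (continuous_const.mul continuous_id).matrix_trace
  have hq : Tendsto (fun k : ℕ => p / 2 ^ k) atTop (𝓝[≠] 0) := by
    refine tendsto_nhdsWithin_iff.2 ⟨?_, Eventually.of_forall fun k => ?_⟩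
    · exact tendsto_const_nhds.div_atTop (tendsto_pow_atTop_atTop_of_one_lt one_lt_two)
    · exact (show 0 < p / 2 ^ k by positivity).ne'
  exact le_of_tendsto' ((hcont.tendsto _).comp
    ((tendsto_smul_one_sub_inv_powConj hF hY p).comp hq))
    (rtr_mul_one_sub_inv_powConj_le hX hF hY hp htr)

end GoldenThompson

theorem stmt1 {n : Type*} [Fintype n] [DecidableEq n]
    (X Y Z : Matrix n n ℂ) (hX : X.PosDef) (hY : Y.PosDef) (hZ : Z.PosDef)
    (htr : Z.trace = X.trace) (p : ℝ) (hp : 0 < p) :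
    rtr (X * mlog (mpow Y (p / 2) * mpow Z p * mpow Y (p / 2))) ≤
      rtr (X * (mlog (mpow X p) + mlog (mpow Y p))) := by
  set F := mpow Y (p / 2) * mpow Z p * mpow Y (p / 2) with hF_def
  have hF : F.PosDef := posDef_conj (posDef_mpow hZ p) (posDef_mpow hY _)
  have hΦ : powConj F Y p p = mpow Z p := by
    have e1 : mpow Y (p / 2) * mpow Y (-p / 2) = 1 := by
      rw [mpow_mul_mpow hY, ← mpow_zero hY]
      ring_nf
    rw [powConj, div_self hp.ne', mpow_one hF, hF_def, mul_assoc, mul_assoc, e1, mul_one,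
      ← mul_assoc, mul_eq_one_comm.1 e1, one_mul]
  have h := rtr_mul_sub_mlog_le hX hF hY hp (by
    rw [hΦ, mpow_mpow hZ, mul_one_div_cancel hp.ne', mpow_one hZ, rtr, htr, rtr])
  rw [mul_sub, rtr_sub, mul_smul_comm, rtr_smul] at h
  rw [mlog_mpow hX, mlog_mpow hY, mul_add, rtr_add, mul_smul_comm, mul_smul_comm, rtr_smul,
    rtr_smul]
  have h2 := mul_le_mul_of_nonneg_left h hp.le
  rw [mul_sub, ← mul_assoc, mul_one_div_cancel hp.ne', one_mul] at h2
  linarith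
end

section
/- For all n×n positive definite matrices X, Y, Z with Tr[Z] = Tr[X], Tr[X log(∫₀^∞ (λ+Y)⁻¹ Z (λ+Y)⁻¹ dλ)] ≤ Tr[X (log X − log Y)]. -/
open Matrix ComplexOrder

theorem sum_mul_log_le_of_sum_div_le {ι κ : Type*} [Fintype ι] [Fintype κ]
    {α r : ι → ℝ} {β s : κ → ℝ} (hr : ∀ i, 0 < r i) (hs : ∀ j, 0 < s j)
    (hsum : ∑ i, α i = ∑ j, β j)
    (h : ∀ t : ℝ, 0 ≤ t → ∑ j, β j / (t + s j) ≤ ∑ i, α i / (t + r i)) :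
    ∑ i, α i * Real.log (r i) ≤ ∑ j, β j * Real.log (s j) := by
  set F : ℝ → ℝ := fun t =>
    ∑ i, α i * Real.log (t + r i) - ∑ j, β j * Real.log (t + s j) with hF
  have hderiv : ∀ t : ℝ, 0 ≤ t →
      HasDerivAt F (∑ i, α i / (t + r i) - ∑ j, β j / (t + s j)) t := by
    intro t ht
    refine HasDerivAt.sub (HasDerivAt.fun_sum fun i _ => ?_) (HasDerivAt.fun_sum fun j _ => ?_)
    · have hne : t + r i ≠ 0 := (add_pos_of_nonneg_of_pos ht (hr i)).ne'
      simpa [div_eq_mul_inv] using (((hasDerivAt_id t).add_const (r i)).log hne).const_mul (α i)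
    · have hne : t + s j ≠ 0 := (add_pos_of_nonneg_of_pos ht (hs j)).ne'
      simpa [div_eq_mul_inv] using (((hasDerivAt_id t).add_const (s j)).log hne).const_mul (β j)
  have hmono : MonotoneOn F (Set.Ici 0) := by
    refine monotoneOn_of_hasDerivWithinAt_nonneg (convex_Ici 0)
      (fun t ht => (hderiv t ht).continuousAt.continuousWithinAt)
      (fun t ht => (hderiv t (interior_subset ht)).hasDerivWithinAt) fun t ht => ?_
    exact sub_nonneg.2 (h t (interior_subset ht))
  have hlog (c : ℝ) :
      Filter.Tendsto (fun t : ℝ => Real.log (t + c) - Real.log t) Filter.atTop (nhds 0) :=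
    Real.tendsto_log_comp_add_sub_log c
  have hlim : Filter.Tendsto F Filter.atTop (nhds 0) := by
    have hF' : F = fun t => ∑ i, α i * (Real.log (t + r i) - Real.log t) -
        ∑ j, β j * (Real.log (t + s j) - Real.log t) := by
      funext t
      simp only [hF, mul_sub, Finset.sum_sub_distrib, ← Finset.sum_mul, hsum]
      ring
    rw [hF']
    have := (tendsto_finsetSum Finset.univ fun i _ => (hlog (r i)).const_mul (α i)).sub
      (tendsto_finsetSum Finset.univ fun j _ => (hlog (s j)).const_mul (β j))
    simpa using this
  have h0 : F 0 ≤ 0 := ge_of_tendsto hlim <| by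
    filter_upwards [Filter.eventually_ge_atTop 0] with t ht
    exact hmono (Set.mem_Ici.2 le_rfl) ht ht
  simpa [hF] using h0

theorem re_trace_conj_diagonal_mul {n : Type*} [Fintype n] [DecidableEq n]
    (P Q : Matrix n n ℂ) (p q : n → ℝ) :
    ((P * diagonal (fun a => (p a : ℂ)) * Pᴴ) *
      (Q * diagonal (fun b => (q b : ℂ)) * Qᴴ)).trace.re =
      ∑ a, ∑ b, p a * q b * Complex.normSq ((Pᴴ * Q) a b) := by
  have : ((P * diagonal (fun a => (p a : ℂ)) * Pᴴ) *
      (Q * diagonal (fun b => (q b : ℂ)) * Qᴴ)).trace =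
      (diagonal (fun a => (p a : ℂ)) * ((Pᴴ * Q) * diagonal (fun b => (q b : ℂ)) *
        (Pᴴ * Q)ᴴ)).trace := by
    rw [Matrix.mul_assoc P, Matrix.mul_assoc P, Matrix.trace_mul_comm P]
    simp only [conjTranspose_mul, conjTranspose_conjTranspose, Matrix.mul_assoc]
  rw [this, Matrix.trace, Complex.re_sum]
  refine Finset.sum_congr rfl fun a _ => ?_
  rw [diag_apply, diagonal_mul, mul_apply, Finset.mul_sum, Complex.re_sum]
  refine Finset.sum_congr rfl fun b _ => ?_
  rw [mul_diagonal, conjTranspose_apply, mul_right_comm, ← starRingEnd_apply, Complex.mul_conj]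
  norm_cast
  ring

theorem mul_re_sub_mul_normSq_le (z w : ℂ) (p : ℝ) {s : ℝ} (hs : 0 < s) :
    2 * (p * (w * star z).re) - s * Complex.normSq w ≤ p ^ 2 * Complex.normSq z / s := by
  rw [le_div_iff₀ hs]
  have h := Complex.normSq_nonneg (p * z - s * w)
  simp only [Complex.normSq_apply, Complex.sub_re, Complex.sub_im, Complex.mul_re, Complex.mul_im,
    Complex.ofReal_re, Complex.ofReal_im, Complex.star_def, Complex.conj_re, Complex.conj_im] at h ⊢
  nlinarith [h]

theorem mul_re_sub_le_mul_normSq_div (z w : ℂ) {t p q : ℝ} (ht : 0 ≤ t) (hp : 0 < p)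
    (hq : 0 < q) :
    2 * (p * (w * star z).re) - t * (p * Complex.normSq w) - q * Complex.normSq w ≤
      p * Complex.normSq z / (t + q / p) := by
  have hs : 0 < t * p + q := add_pos_of_nonneg_of_pos (mul_nonneg ht hp.le) hq
  have e : t + q / p = (t * p + q) / p := by field_simp
  have e' : p * Complex.normSq z / (t + q / p) = p ^ 2 * Complex.normSq z / (t * p + q) := by
    rw [e]
    field_simp
  rw [e']
  linarith [mul_re_sub_mul_normSq_le z w p hs]

theorem div_add_div_eq {t x y : ℝ} (hx : x ≠ 0) (hd : t * x + y ≠ 0) :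
    x / (t + y / x) = 2 * (x / (t * x + y) * x) - t * ((x / (t * x + y)) ^ 2 * x) -
      (x / (t * x + y)) ^ 2 * y := by
  have e : t + y / x = (t * x + y) / x := by field_simp
  have e' : x / ((t * x + y) / x) = x ^ 2 / (t * x + y) := by field_simp
  rw [e, e', div_eq_iff hd]
  generalize hu : t * x + y = u at hd ⊢
  have : y = u - t * x := by linarith
  subst this
  field_simp
  ring

theorem trace_diagonal_mul_mul_diagonal_mul {n : Type*} [Fintype n] [DecidableEq n]
    (L M : Matrix n n ℂ) (p q : n → ℝ) :
    (diagonal (fun a => (p a : ℂ)) * (L * diagonal (fun b => (q b : ℂ)) * Mᴴ)).trace.re =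
      ∑ a, ∑ b, p a * q b * (L a b * star (M a b)).re := by
  rw [Matrix.trace, Complex.re_sum]
  refine Finset.sum_congr rfl fun a _ => ?_
  rw [diag_apply, diagonal_mul, mul_apply, Finset.mul_sum, Complex.re_sum]
  refine Finset.sum_congr rfl fun b _ => ?_
  rw [mul_diagonal, conjTranspose_apply, mul_right_comm, mul_comm (L a b * _), ← mul_assoc,
    ← Complex.ofReal_mul, Complex.re_ofReal_mul]

theorem sum_re_mul_star_eq_re_trace {n : Type*} [Fintype n] [DecidableEq n]
    {P Q : Matrix n n ℂ} (hQ : Q * Qᴴ = 1) (J K : Matrix n n ℂ) (p : n → ℝ) :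
    ∑ a, ∑ b, p a * ((Pᴴ * K * Q) a b * star ((Pᴴ * J * Q) a b)).re =
      ((P * diagonal (fun a => (p a : ℂ)) * Pᴴ) * (K * Jᴴ)).trace.re := by
  have e := trace_diagonal_mul_mul_diagonal_mul (Pᴴ * K * Q) (Pᴴ * J * Q) p (fun _ => 1)
  simp only [mul_one] at e
  rw [← e, Matrix.mul_assoc P, Matrix.mul_assoc P, Matrix.trace_mul_comm P]
  have : Pᴴ * K * Q * diagonal (fun _ => ((1 : ℝ) : ℂ)) * (Pᴴ * J * Q)ᴴ =
      Pᴴ * (K * Jᴴ) * P := by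
    calc _ = Pᴴ * K * (Q * Qᴴ) * Jᴴ * P := by
          simp only [Complex.ofReal_one, diagonal_one, Matrix.mul_one, conjTranspose_mul,
            conjTranspose_conjTranspose, Matrix.mul_assoc]
      _ = _ := by rw [hQ, Matrix.mul_one, Matrix.mul_assoc Pᴴ K Jᴴ]
  rw [this]
  simp only [Matrix.mul_assoc]

theorem sum_mul_normSq_eq_re_trace {n : Type*} [Fintype n] [DecidableEq n]
    {P Q : Matrix n n ℂ} (hP : P * Pᴴ = 1) (K : Matrix n n ℂ) (q : n → ℝ) :
    ∑ a, ∑ b, q b * Complex.normSq ((Pᴴ * K * Q) a b) =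
      ((Q * diagonal (fun b => (q b : ℂ)) * Qᴴ) * (Kᴴ * K)).trace.re := by
  have e := trace_diagonal_mul_mul_diagonal_mul (Pᴴ * K * Q) (Pᴴ * K * Q) (fun _ => 1) q
  simp only [one_mul, Complex.star_def, Complex.mul_conj, Complex.ofReal_re] at e
  have : Pᴴ * K * Q * diagonal (fun b => (q b : ℂ)) * (Pᴴ * K * Q)ᴴ =
      Pᴴ * (K * (Q * diagonal (fun b => (q b : ℂ)) * Qᴴ) * Kᴴ * P) := by
    simp only [conjTranspose_mul, conjTranspose_conjTranspose, Matrix.mul_assoc]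
  rw [← e, this]
  simp only [Complex.ofReal_one, diagonal_one, Matrix.one_mul]
  rw [Matrix.trace_mul_comm Pᴴ, Matrix.mul_assoc _ P, hP, Matrix.mul_one, Matrix.mul_assoc K,
    Matrix.trace_mul_comm K, Matrix.mul_assoc _ Kᴴ K]

theorem re_trace_conj_diagonal_mul_of_sum {n : Type*} [Fintype n] [DecidableEq n]
    (P R : Matrix n n ℂ) {p x : n → ℝ}
    (hx : ∀ i, x i = ∑ a, p a * Complex.normSq ((Pᴴ * R) a i)) (c : n → ℝ) :
    ((P * diagonal (fun a => (p a : ℂ)) * Pᴴ) *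
      (R * diagonal (fun i => (c i : ℂ)) * Rᴴ)).trace.re = ∑ i, c i * x i := by
  rw [re_trace_conj_diagonal_mul, Finset.sum_comm]
  refine Finset.sum_congr rfl fun i _ => ?_
  rw [hx, Finset.mul_sum]
  exact Finset.sum_congr rfl fun a _ => by ring

theorem conjTranspose_conj_diagonal {n : Type*} [Fintype n] [DecidableEq n]
    (R : Matrix n n ℂ) (c : n → ℝ) :
    (R * diagonal (fun i => (c i : ℂ)) * Rᴴ)ᴴ = R * diagonal (fun i => (c i : ℂ)) * Rᴴ := by
  refine isHermitian_mul_mul_conjTranspose R (isHermitian_diagonal_iff.2 fun i => ?_)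
  exact Complex.conj_ofReal (c i)

theorem conj_diagonal_mul_self {n : Type*} [Fintype n] [DecidableEq n]
    {R : Matrix n n ℂ} (hR : Rᴴ * R = 1) (c : n → ℝ) :
    (R * diagonal (fun i => (c i : ℂ)) * Rᴴ) * (R * diagonal (fun i => (c i : ℂ)) * Rᴴ) =
      R * diagonal (fun i => ((c i ^ 2 : ℝ) : ℂ)) * Rᴴ := by
  calc _ = R * diagonal (fun i => (c i : ℂ)) * (Rᴴ * R) *
        diagonal (fun i => (c i : ℂ)) * Rᴴ := by simp only [Matrix.mul_assoc]
    _ = _ := by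
      rw [hR, Matrix.mul_one, Matrix.mul_assoc R, diagonal_mul_diagonal]
      simp only [sq, Complex.ofReal_mul]

theorem sum_div_le_sum_div_of_unitary {n : Type*} [Fintype n] [DecidableEq n]
    {P Q R : Matrix n n ℂ} (hP : P ∈ unitaryGroup n ℂ) (hQ : Q ∈ unitaryGroup n ℂ)
    (hR : R ∈ unitaryGroup n ℂ) {p q : n → ℝ} (hp : ∀ a, 0 < p a) (hq : ∀ b, 0 < q b)
    {x y : n → ℝ} (hx : ∀ i, x i = ∑ a, p a * Complex.normSq ((Pᴴ * R) a i))
    (hy : ∀ i, y i = ∑ b, q b * Complex.normSq ((Qᴴ * R) b i))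
    (hx0 : ∀ i, 0 < x i) (hy0 : ∀ i, 0 < y i) {t : ℝ} (ht : 0 ≤ t) :
    ∑ i, x i / (t + y i / x i) ≤
      ∑ ab : n × n, p ab.1 * Complex.normSq ((Pᴴ * Q) ab.1 ab.2) / (t + q ab.2 / p ab.1) := by
  have hP1 : P * Pᴴ = 1 := mem_unitaryGroup_iff.1 hP
  have hQ1 : Q * Qᴴ = 1 := mem_unitaryGroup_iff.1 hQ
  set c : n → ℝ := fun i => x i / (t * x i + y i) with hc
  have hd (i : n) : 0 < t * x i + y i :=
    add_pos_of_nonneg_of_pos (mul_nonneg ht (hx0 i).le) (hy0 i)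
  obtain ⟨K, hK⟩ : ∃ K : Matrix n n ℂ, K = R * diagonal (fun i => (c i : ℂ)) * Rᴴ := ⟨_, rfl⟩
  have hKH : Kᴴ = K := hK ▸ conjTranspose_conj_diagonal R c
  have hKK : K * K = R * diagonal (fun i => ((c i ^ 2 : ℝ) : ℂ)) * Rᴴ :=
    hK ▸ conj_diagonal_mul_self (mem_unitaryGroup_iff'.1 hR) c
  obtain ⟨L, hL⟩ : ∃ L : Matrix n n ℂ, L = Pᴴ * K * Q := ⟨_, rfl⟩
  obtain ⟨M, hM⟩ : ∃ M : Matrix n n ℂ, M = Pᴴ * Q := ⟨_, rfl⟩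
  rw [← hM, Fintype.sum_prod_type]
  have h1 : ∑ a, ∑ b, p a * (L a b * star (M a b)).re = ∑ i, c i * x i := by
    have e := sum_re_mul_star_eq_re_trace (P := P) hQ1 1 K p
    rw [conjTranspose_one, Matrix.mul_one, Matrix.mul_one] at e
    rw [hL, hM, e, hK, re_trace_conj_diagonal_mul_of_sum P R hx]
  have h2 : ∑ a, ∑ b, p a * Complex.normSq (L a b) = ∑ i, c i ^ 2 * x i := by
    have e := sum_re_mul_star_eq_re_trace (P := P) hQ1 K K p
    simp only [Complex.star_def, Complex.mul_conj, Complex.ofReal_re] at e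
    rw [hL, e, hKH, hKK, re_trace_conj_diagonal_mul_of_sum P R hx fun i => c i ^ 2]
  have h3 : ∑ a, ∑ b, q b * Complex.normSq (L a b) = ∑ i, c i ^ 2 * y i := by
    rw [hL, sum_mul_normSq_eq_re_trace hP1, hKH, hKK,
      re_trace_conj_diagonal_mul_of_sum Q R hy fun i => c i ^ 2]
  calc ∑ i, x i / (t + y i / x i)
      = ∑ i, (2 * (c i * x i) - t * (c i ^ 2 * x i) - c i ^ 2 * y i) :=
        Finset.sum_congr rfl fun i _ => div_add_div_eq (hx0 i).ne' (hd i).ne'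
    _ = 2 * ∑ i, c i * x i - t * ∑ i, c i ^ 2 * x i - ∑ i, c i ^ 2 * y i := by
        rw [Finset.sum_sub_distrib, Finset.sum_sub_distrib, Finset.mul_sum, Finset.mul_sum]
    _ = ∑ a, ∑ b, (2 * (p a * (L a b * star (M a b)).re) -
          t * (p a * Complex.normSq (L a b)) - q b * Complex.normSq (L a b)) := by
        rw [← h1, ← h2, ← h3]
        simp only [Finset.sum_sub_distrib, ← Finset.mul_sum]
    _ ≤ ∑ a, ∑ b, p a * Complex.normSq (M a b) / (t + q b / p a) :=
        Finset.sum_le_sum fun a _ => Finset.sum_le_sum fun b _ =>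
          mul_re_sub_le_mul_normSq_div (M a b) (L a b) ht (hp a) (hq b)

theorem integrableOn_inv_add_sq {q : ℝ} (hq : 0 < q) :
    MeasureTheory.IntegrableOn (fun l : ℝ => ((l + q) ^ 2)⁻¹) (Set.Ioi 0) ∧
      ∫ l in Set.Ioi (0 : ℝ), ((l + q) ^ 2)⁻¹ = q⁻¹ := by
  have hd : ∀ l ∈ Set.Ici (0 : ℝ), HasDerivAt (fun l : ℝ => -(l + q)⁻¹) ((l + q) ^ 2)⁻¹ l := by
    intro l hl
    have hne : l + q ≠ 0 := (add_pos_of_nonneg_of_pos hl hq).ne'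
    have h := (((hasDerivAt_id l).add_const q).inv hne).neg
    rw [neg_div, neg_neg, one_div] at h
    exact h
  have hpos : ∀ l ∈ Set.Ioi (0 : ℝ), 0 ≤ ((l + q) ^ 2)⁻¹ := fun l _ => by positivity
  have hlim : Filter.Tendsto (fun l : ℝ => -(l + q)⁻¹) Filter.atTop (nhds 0) := by
    simpa using (tendsto_inv_atTop_zero.comp
      (Filter.tendsto_atTop_add_const_right _ q Filter.tendsto_id)).neg
  refine ⟨MeasureTheory.integrableOn_Ioi_deriv_of_nonneg' hd hpos hlim, ?_⟩
  simpa using MeasureTheory.integral_Ioi_of_hasDerivAt_of_nonneg' hd hpos hlim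

theorem integrableOn_inv_add_mul_inv_add {q r : ℝ} (hq : 0 < q) (hr : 0 < r) :
    MeasureTheory.IntegrableOn (fun l : ℝ => (l + q)⁻¹ * (l + r)⁻¹) (Set.Ioi 0) := by
  refine MeasureTheory.Integrable.mono'
    ((integrableOn_inv_add_sq hq).1.add (integrableOn_inv_add_sq hr).1)
    (by fun_prop) ?_
  refine Filter.Eventually.of_forall fun l => ?_
  rw [Real.norm_eq_abs, abs_le]
  simp only [Pi.add_apply, ← inv_pow]
  constructor <;> nlinarith [sq_nonneg ((l + q)⁻¹ + (l + r)⁻¹), sq_nonneg ((l + q)⁻¹ - (l + r)⁻¹),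
    sq_nonneg ((l + q)⁻¹), sq_nonneg ((l + r)⁻¹)]

theorem inv_smul_one_add_conj_diagonal {n : Type*} [Fintype n] [DecidableEq n]
    {Q : Matrix n n ℂ} (hQ : Q ∈ unitaryGroup n ℂ) {q : n → ℝ} (hq : ∀ b, 0 < q b)
    {l : ℝ} (hl : 0 < l) :
    ((l : ℂ) • 1 + Q * diagonal (fun b => (q b : ℂ)) * Qᴴ)⁻¹ =
      Q * diagonal (fun b => (((l + q b)⁻¹ : ℝ) : ℂ)) * Qᴴ := by
  have hQ1 : Q * Qᴴ = 1 := mem_unitaryGroup_iff.1 hQ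
  have hQ2 : Qᴴ * Q = 1 := mem_unitaryGroup_iff'.1 hQ
  refine inv_eq_right_inv ?_
  have e : (l : ℂ) • 1 + Q * diagonal (fun b => (q b : ℂ)) * Qᴴ =
      Q * diagonal (fun b => ((l + q b : ℝ) : ℂ)) * Qᴴ := by
    have : diagonal (fun b => ((l + q b : ℝ) : ℂ)) =
        (l : ℂ) • 1 + diagonal (fun b => (q b : ℂ)) := by
      rw [smul_one_eq_diagonal, diagonal_add]
      simp
    rw [this, Matrix.mul_add, Matrix.add_mul, Matrix.mul_smul, Matrix.mul_one, Matrix.smul_mul,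
      hQ1]
  calc _ = Q * diagonal (fun b => ((l + q b : ℝ) : ℂ)) * (Qᴴ * Q) *
        diagonal (fun b => (((l + q b)⁻¹ : ℝ) : ℂ)) * Qᴴ := by rw [e]; simp only [Matrix.mul_assoc]
    _ = Q * 1 * Qᴴ := by
      rw [hQ2, Matrix.mul_one, Matrix.mul_assoc Q, diagonal_mul_diagonal, ← diagonal_one]
      congr! with b
      rw [← Complex.ofReal_mul, mul_inv_cancel₀ (add_pos hl (hq b)).ne', Complex.ofReal_one]
    _ = 1 := by rw [Matrix.mul_one, hQ1]

theorem integral_inv_mul_mul_inv_eq {n : Type*} [Fintype n] [DecidableEq n]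
    {Q : Matrix n n ℂ} (hQ : Q ∈ unitaryGroup n ℂ) {q : n → ℝ} (hq : ∀ b, 0 < q b)
    (Z : Matrix n n ℂ) :
    (Matrix.of fun i j => ∫ l in Set.Ioi (0 : ℝ),
      (((l : ℂ) • 1 + Q * diagonal (fun b => (q b : ℂ)) * Qᴴ)⁻¹ * Z *
        ((l : ℂ) • 1 + Q * diagonal (fun b => (q b : ℂ)) * Qᴴ)⁻¹) i j) =
      Q * (Matrix.of fun b c => (Qᴴ * Z * Q) b c *
        ((∫ l in Set.Ioi (0 : ℝ), (l + q b)⁻¹ * (l + q c)⁻¹ : ℝ) : ℂ)) * Qᴴ := by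
  ext i j
  rw [of_apply]
  have e : ∀ l ∈ Set.Ioi (0 : ℝ),
      (((l : ℂ) • 1 + Q * diagonal (fun b => (q b : ℂ)) * Qᴴ)⁻¹ * Z *
        ((l : ℂ) • 1 + Q * diagonal (fun b => (q b : ℂ)) * Qᴴ)⁻¹) i j =
      ∑ c, ∑ b, (Q i b * (Qᴴ * Z * Q) b c * Qᴴ c j) *
        (((l + q b)⁻¹ * (l + q c)⁻¹ : ℝ) : ℂ) := by
    intro l hl
    rw [inv_smul_one_add_conj_diagonal hQ hq hl]
    have : Q * diagonal (fun b => (((l + q b)⁻¹ : ℝ) : ℂ)) * Qᴴ * Z *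
        (Q * diagonal (fun b => (((l + q b)⁻¹ : ℝ) : ℂ)) * Qᴴ) =
        (Q * diagonal (fun b => (((l + q b)⁻¹ : ℝ) : ℂ))) * (Qᴴ * Z * Q) *
          diagonal (fun b => (((l + q b)⁻¹ : ℝ) : ℂ)) * Qᴴ := by
      simp only [Matrix.mul_assoc]
    rw [this, mul_apply]
    refine Finset.sum_congr rfl fun c _ => ?_
    rw [mul_diagonal, mul_apply, Finset.sum_mul, Finset.sum_mul]
    refine Finset.sum_congr rfl fun b _ => ?_
    rw [mul_diagonal]
    push_cast
    ring
  have hint (b c : n) : MeasureTheory.Integrable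
      (fun l : ℝ => (((l + q b)⁻¹ * (l + q c)⁻¹ : ℝ) : ℂ))
      (MeasureTheory.volume.restrict (Set.Ioi 0)) :=
    (integrableOn_inv_add_mul_inv_add (hq b) (hq c)).ofReal
  rw [MeasureTheory.setIntegral_congr_fun measurableSet_Ioi e,
    MeasureTheory.integral_finsetSum _ fun c _ =>
      MeasureTheory.integrable_finsetSum _ fun b _ => (hint b c).const_mul _, mul_apply]
  refine Finset.sum_congr rfl fun c _ => ?_
  rw [MeasureTheory.integral_finsetSum _ fun b _ => (hint b c).const_mul _, mul_apply,
    Finset.sum_mul]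
  refine Finset.sum_congr rfl fun b _ => ?_
  rw [MeasureTheory.integral_const_mul, integral_complex_ofReal, of_apply]
  ring

theorem posDef_mul_integral_inv_mul_inv {n : Type*} [Fintype n] [DecidableEq n]
    {q : n → ℝ} (hq : ∀ b, 0 < q b) {Z : Matrix n n ℂ} (hZ : Z.PosDef) :
    (Matrix.of fun b c => Z b c *
      ((∫ l in Set.Ioi (0 : ℝ), (l + q b)⁻¹ * (l + q c)⁻¹ : ℝ) : ℂ)).PosDef := by
  have hherm : (Matrix.of fun b c => Z b c *
      ((∫ l in Set.Ioi (0 : ℝ), (l + q b)⁻¹ * (l + q c)⁻¹ : ℝ) : ℂ)).IsHermitian := by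
    ext b c
    rw [conjTranspose_apply, of_apply, of_apply, star_mul', hZ.isHermitian.apply,
      Complex.star_def, Complex.conj_ofReal]
    simp only [mul_comm]
  refine PosDef.of_dotProduct_mulVec_pos hherm fun x hx => ?_
  set f : ℝ → ℝ := fun l =>
    (star (fun b => (((l + q b)⁻¹ : ℝ) : ℂ) * x b) ⬝ᵥ
      (Z *ᵥ fun b => (((l + q b)⁻¹ : ℝ) : ℂ) * x b)).re with hf
  have hfpos : ∀ l ∈ Set.Ioi (0 : ℝ), 0 < f l := by
    intro l hl
    refine hZ.re_dotProduct_pos fun h => hx <| funext fun b => ?_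
    have hb := congrFun h b
    simpa [Complex.ofReal_eq_zero, (add_pos hl (hq b)).ne', ← Complex.ofReal_add] using hb
  have hfsum (l : ℝ) : f l = ∑ b, ∑ c, (star (x b) * Z b c * x c).re *
      ((l + q b)⁻¹ * (l + q c)⁻¹) := by
    simp only [hf, dotProduct, mulVec, Finset.mul_sum, Complex.re_sum]
    refine Finset.sum_congr rfl fun b _ => Finset.sum_congr rfl fun c _ => ?_
    rw [mul_comm (Complex.re _), ← Complex.re_ofReal_mul]
    congr 1
    simp only [Pi.star_apply, star_mul', Complex.star_def, Complex.conj_ofReal]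
    push_cast
    ring
  have hint (b c : n) (z : ℝ) : MeasureTheory.Integrable
      (fun l : ℝ => z * ((l + q b)⁻¹ * (l + q c)⁻¹))
      (MeasureTheory.volume.restrict (Set.Ioi 0)) :=
    (integrableOn_inv_add_mul_inv_add (hq b) (hq c)).const_mul z
  have hfint : MeasureTheory.IntegrableOn f (Set.Ioi 0) := by
    rw [funext hfsum]
    exact MeasureTheory.integrable_finsetSum _ fun b _ =>
      MeasureTheory.integrable_finsetSum _ fun c _ => hint b c _
  have hpos : 0 < ∫ l in Set.Ioi (0 : ℝ), f l := by
    rw [MeasureTheory.setIntegral_pos_iff_support_of_nonneg_ae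
      ((MeasureTheory.ae_restrict_mem measurableSet_Ioi).mono fun l hl => (hfpos l hl).le) hfint]
    rw [Set.inter_eq_right.2 fun l hl => Function.mem_support.2 (hfpos l hl).ne']
    simp
  have hre : (star x ⬝ᵥ ((Matrix.of fun b c => Z b c *
      ((∫ l in Set.Ioi (0 : ℝ), (l + q b)⁻¹ * (l + q c)⁻¹ : ℝ) : ℂ)) *ᵥ x)).re =
      ∫ l in Set.Ioi (0 : ℝ), f l := by
    rw [funext hfsum, MeasureTheory.integral_finsetSum _ fun b _ =>
      MeasureTheory.integrable_finsetSum _ fun c _ => hint b c _]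
    simp only [dotProduct, mulVec, Finset.mul_sum, Complex.re_sum]
    refine Finset.sum_congr rfl fun b _ => ?_
    rw [MeasureTheory.integral_finsetSum _ fun c _ => hint b c _]
    refine Finset.sum_congr rfl fun c _ => ?_
    rw [MeasureTheory.integral_const_mul, mul_comm (Complex.re _), ← Complex.re_ofReal_mul]
    congr 1
    simp only [Pi.star_apply, of_apply]
    ring
  have him := hherm.im_star_dotProduct_mulVec_self x
  refine Complex.pos_iff.2 ⟨hre ▸ hpos, ?_⟩
  simpa using him.symm

theorem posDef_integral_inv_mul_mul_inv_and_trace_mul {n : Type*} [Fintype n] [DecidableEq n]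
    {Q : Matrix n n ℂ} (hQ : Q ∈ unitaryGroup n ℂ) {q : n → ℝ} (hq : ∀ b, 0 < q b)
    {Z : Matrix n n ℂ} (hZ : Z.PosDef) {W : Matrix n n ℂ}
    (hW : W = Matrix.of fun i j => ∫ l in Set.Ioi (0 : ℝ),
      (((l : ℂ) • 1 + Q * diagonal (fun b => (q b : ℂ)) * Qᴴ)⁻¹ * Z *
        ((l : ℂ) • 1 + Q * diagonal (fun b => (q b : ℂ)) * Qᴴ)⁻¹) i j) :
    W.PosDef ∧ ((Q * diagonal (fun b => (q b : ℂ)) * Qᴴ) * W).trace = Z.trace := by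
  have hQ1 : Q * Qᴴ = 1 := mem_unitaryGroup_iff.1 hQ
  have hQ2 : Qᴴ * Q = 1 := mem_unitaryGroup_iff'.1 hQ
  rw [integral_inv_mul_mul_inv_eq hQ hq] at hW
  have hinj : Function.Injective Q.mulVec := fun u v h => by
    simpa [mulVec_mulVec, hQ2] using congrArg (Qᴴ *ᵥ ·) h
  have hinj' : Function.Injective fun v => v ᵥ* Q := fun u v h => by
    simpa [vecMul_vecMul, hQ1] using congrArg (· ᵥ* Qᴴ) h
  have hinjH : Function.Injective fun v => v ᵥ* Qᴴ := fun u v h => by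
    simpa [vecMul_vecMul, hQ2] using congrArg (· ᵥ* Q) h
  have hZ' : (Qᴴ * Z * Q).PosDef := hZ.conjTranspose_mul_mul_same hinj
  refine ⟨?_, ?_⟩
  · rw [hW]
    exact (posDef_mul_integral_inv_mul_inv hq hZ').mul_mul_conjTranspose_same hinj'
  · set V : Matrix n n ℂ := Matrix.of fun b c => (Qᴴ * Z * Q) b c *
      ((∫ l in Set.Ioi (0 : ℝ), (l + q b)⁻¹ * (l + q c)⁻¹ : ℝ) : ℂ) with hV
    have e : (Q * diagonal (fun b => (q b : ℂ)) * Qᴴ) * W =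
        Q * (diagonal (fun b => (q b : ℂ)) * V * Qᴴ) := by
      calc _ = Q * diagonal (fun b => (q b : ℂ)) * (Qᴴ * Q) * V * Qᴴ := by
            rw [hW]
            simp only [Matrix.mul_assoc]
        _ = _ := by
            rw [hQ2, Matrix.mul_one]
            simp only [Matrix.mul_assoc]
    have e' : Z.trace = (Qᴴ * Z * Q).trace := by
      rw [Matrix.mul_assoc, Matrix.trace_mul_comm Qᴴ, Matrix.mul_assoc, hQ1, Matrix.mul_one]
    rw [e, Matrix.trace_mul_comm Q, Matrix.mul_assoc _ Qᴴ, hQ2, Matrix.mul_one, e',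
      Matrix.trace, Matrix.trace]
    refine Finset.sum_congr rfl fun b _ => ?_
    rw [diag_apply, diag_apply, diagonal_mul, hV, of_apply]
    have hk : ∫ l in Set.Ioi (0 : ℝ), (l + q b)⁻¹ * (l + q b)⁻¹ = (q b)⁻¹ := by
      rw [← (integrableOn_inv_add_sq (hq b)).2]
      simp only [sq, mul_inv]
    rw [hk, Complex.ofReal_inv]
    have : (q b : ℂ) ≠ 0 := Complex.ofReal_ne_zero.2 (hq b).ne'
    field_simp

theorem Matrix.PosDef.exists_unitary_diagonal {n : Type*} [Fintype n] [DecidableEq n]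
    {A : Matrix n n ℂ} (hA : A.PosDef) :
    ∃ U ∈ unitaryGroup n ℂ, ∃ a : n → ℝ, (∀ i, 0 < a i) ∧
      A = U * diagonal (fun i => (a i : ℂ)) * Uᴴ ∧
      mlog A = U * diagonal (fun i => (Real.log (a i) : ℂ)) * Uᴴ := by
  refine ⟨hA.1.eigenvectorUnitary, hA.1.eigenvectorUnitary.2, hA.1.eigenvalues,
    hA.eigenvalues_pos, ?_, ?_⟩
  · conv_lhs => rw [hA.1.spectral_theorem]
    rfl
  · rw [mlog, hA.1.cfc_eq]
    rfl

theorem sum_mul_normSq_pos_of_unitary {n : Type*} [Fintype n] [DecidableEq n]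
    {P R : Matrix n n ℂ} (hP : P ∈ unitaryGroup n ℂ) (hR : R ∈ unitaryGroup n ℂ) {p : n → ℝ}
    (hp : ∀ a, 0 < p a) (i : n) : 0 < ∑ a, p a * Complex.normSq ((Pᴴ * R) a i) := by
  have hPR : (Pᴴ * R)ᴴ * (Pᴴ * R) = 1 := by
    calc _ = Rᴴ * (P * Pᴴ) * R := by
          simp only [conjTranspose_mul, conjTranspose_conjTranspose, Matrix.mul_assoc]
      _ = 1 := by
          rw [show P * Pᴴ = 1 from mem_unitaryGroup_iff.1 hP, Matrix.mul_one]
          exact mem_unitaryGroup_iff'.1 hR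
  obtain ⟨a, ha⟩ : ∃ a, (Pᴴ * R) a i ≠ 0 := by
    by_contra! h
    have := congrFun (congrFun hPR i) i
    rw [mul_apply, one_apply_eq, Finset.sum_eq_zero fun a _ => by rw [h, mul_zero]] at this
    exact zero_ne_one this
  exact Finset.sum_pos' (fun a _ => mul_nonneg (hp a).le (Complex.normSq_nonneg _))
    ⟨a, Finset.mem_univ a, mul_pos (hp a) (Complex.normSq_pos.2 ha)⟩

/-- Measuring in an orthonormal basis does not increase the relative entropy. -/
theorem sum_mul_log_div_le_of_unitary {n : Type*} [Fintype n] [DecidableEq n]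
    {P Q R : Matrix n n ℂ} (hP : P ∈ unitaryGroup n ℂ) (hQ : Q ∈ unitaryGroup n ℂ)
    (hR : R ∈ unitaryGroup n ℂ) {p q : n → ℝ} (hp : ∀ a, 0 < p a) (hq : ∀ b, 0 < q b)
    {x y : n → ℝ} (hx : ∀ i, x i = ∑ a, p a * Complex.normSq ((Pᴴ * R) a i))
    (hy : ∀ i, y i = ∑ b, q b * Complex.normSq ((Qᴴ * R) b i))
    (hx0 : ∀ i, 0 < x i) (hy0 : ∀ i, 0 < y i) :
    ∑ i, x i * (Real.log (x i) - Real.log (y i)) ≤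
      ∑ a, ∑ b, p a * Complex.normSq ((Pᴴ * Q) a b) * (Real.log (p a) - Real.log (q b)) := by
  have htr (S : Matrix n n ℂ) (hS : S ∈ unitaryGroup n ℂ) :
      ∑ a, ∑ b, p a * Complex.normSq ((Pᴴ * S) a b) =
        (P * diagonal (fun a => (p a : ℂ)) * Pᴴ).trace.re := by
    have e := re_trace_conj_diagonal_mul P S p fun _ => 1
    simp only [mul_one, Complex.ofReal_one, diagonal_one] at e
    rw [← e, show S * Sᴴ = 1 from mem_unitaryGroup_iff.1 hS, Matrix.mul_one]
  have hsum : ∑ ab : n × n, p ab.1 * Complex.normSq ((Pᴴ * Q) ab.1 ab.2) = ∑ i, x i := by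
    rw [Fintype.sum_prod_type, htr Q hQ, ← htr R hR, Finset.sum_comm]
    simp only [hx]
  have h := sum_mul_log_le_of_sum_div_le
    (r := fun ab : n × n => q ab.2 / p ab.1) (s := fun i => y i / x i)
    (fun ab => div_pos (hq _) (hp _)) (fun i => div_pos (hy0 i) (hx0 i)) hsum
    fun t ht => sum_div_le_sum_div_of_unitary hP hQ hR hp hq hx hy hx0 hy0 ht
  rw [Fintype.sum_prod_type] at h
  simp only [Real.log_div (hq _).ne' (hp _).ne', Real.log_div (hy0 _).ne' (hx0 _).ne'] at h
  have := neg_le_neg h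
  simpa only [← Finset.sum_neg_distrib, ← mul_neg, neg_sub] using this

theorem stmt2 {n : Type*} [Fintype n] [DecidableEq n]
    (X Y Z : Matrix n n ℂ) (hX : X.PosDef) (hY : Y.PosDef) (hZ : Z.PosDef)
    (htr : Z.trace = X.trace) :
    rtr (X * mlog (Matrix.of fun i j =>
        ∫ l in Set.Ioi (0 : ℝ), (((l : ℂ) • 1 + Y)⁻¹ * Z * ((l : ℂ) • 1 + Y)⁻¹) i j)) ≤
      rtr (X * (mlog X - mlog Y)) := by
  obtain ⟨P, hP, p, hp, hXP, hlogX⟩ := hX.exists_unitary_diagonal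
  obtain ⟨Q, hQ, q, hq, hYQ, hlogY⟩ := hY.exists_unitary_diagonal
  set W : Matrix n n ℂ := Matrix.of fun i j =>
    ∫ l in Set.Ioi (0 : ℝ), (((l : ℂ) • 1 + Y)⁻¹ * Z * ((l : ℂ) • 1 + Y)⁻¹) i j with hW
  rw [hYQ] at hW
  obtain ⟨hWpos, hWtr⟩ := posDef_integral_inv_mul_mul_inv_and_trace_mul hQ hq hZ hW
  obtain ⟨R, hR, w, hw, hWR, hlogW⟩ := hWpos.exists_unitary_diagonal
  set x : n → ℝ := fun i => ∑ a, p a * Complex.normSq ((Pᴴ * R) a i) with hx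
  set y : n → ℝ := fun i => ∑ b, q b * Complex.normSq ((Qᴴ * R) b i) with hy
  have hx0 : ∀ i, 0 < x i := sum_mul_normSq_pos_of_unitary hP hR hp
  have hy0 : ∀ i, 0 < y i := sum_mul_normSq_pos_of_unitary hQ hR hq
  have hlhs : rtr (X * mlog W) = ∑ i, Real.log (w i) * x i := by
    rw [rtr, hlogW, hXP]
    exact re_trace_conj_diagonal_mul_of_sum P R (fun _ => rfl) fun i => Real.log (w i)
  have hsum : ∑ i, w i * y i = ∑ i, x i := by
    have e1 := re_trace_conj_diagonal_mul_of_sum Q R (x := y) (fun _ => rfl) w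
    have e2 := re_trace_conj_diagonal_mul_of_sum P R (x := x) (fun _ => rfl) fun _ => 1
    simp only [Complex.ofReal_one, diagonal_one, Matrix.mul_one, one_mul] at e2
    rw [show R * Rᴴ = 1 from mem_unitaryGroup_iff.1 hR, Matrix.mul_one, ← hXP] at e2
    rw [← e1, ← e2, ← hWR, hWtr, htr]
  have hrhs : rtr (X * (mlog X - mlog Y)) = ∑ a, ∑ b,
      p a * Complex.normSq ((Pᴴ * Q) a b) * (Real.log (p a) - Real.log (q b)) := by
    have e1 := re_trace_conj_diagonal_mul P Q p fun b => Real.log (q b)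
    have e2 := re_trace_conj_diagonal_mul P Q (fun a => p a * Real.log (p a)) fun _ => 1
    have e3 : P * diagonal (fun a => (p a : ℂ)) * Pᴴ *
        (P * diagonal (fun a => (Real.log (p a) : ℂ)) * Pᴴ) =
        P * diagonal (fun a => ((p a * Real.log (p a) : ℝ) : ℂ)) * Pᴴ := by
      calc _ = P * diagonal (fun a => (p a : ℂ)) * (Pᴴ * P) *
            diagonal (fun a => (Real.log (p a) : ℂ)) * Pᴴ := by simp only [Matrix.mul_assoc]
        _ = _ := by
          rw [show Pᴴ * P = 1 from mem_unitaryGroup_iff'.1 hP, Matrix.mul_one,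
            Matrix.mul_assoc P, diagonal_mul_diagonal]
          simp only [Complex.ofReal_mul]
    simp only [mul_one, Complex.ofReal_one, diagonal_one] at e2
    rw [show Q * Qᴴ = 1 from mem_unitaryGroup_iff.1 hQ, Matrix.mul_one, ← e3] at e2
    rw [rtr, hlogX, hlogY, hXP, Matrix.mul_sub, trace_sub, Complex.sub_re, e1, e2,
      ← Finset.sum_sub_distrib]
    refine Finset.sum_congr rfl fun a _ => ?_
    rw [← Finset.sum_sub_distrib]
    exact Finset.sum_congr rfl fun b _ => by ring
  rw [hlhs, hrhs]
  refine le_trans ?_ (sum_mul_log_div_le_of_unitary hP hQ hR hp hq (fun _ => rfl) (fun _ => rfl)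
    hx0 hy0)
  have hterm (i : n) : Real.log (w i) * x i ≤
      x i * (Real.log (x i) - Real.log (y i)) + (w i * y i - x i) := by
    have h := Real.log_le_sub_one_of_pos (div_pos (mul_pos (hw i) (hy0 i)) (hx0 i))
    rw [Real.log_div (mul_pos (hw i) (hy0 i)).ne' (hx0 i).ne',
      Real.log_mul (hw i).ne' (hy0 i).ne'] at h
    have h' := mul_le_mul_of_nonneg_left h (hx0 i).le
    rw [mul_sub (x i) (_ / _), mul_div_cancel₀ _ (hx0 i).ne'] at h'
    linarith
  refine (Finset.sum_le_sum fun i _ => hterm i).trans_eq ?_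
  rw [Finset.sum_add_distrib, Finset.sum_sub_distrib, hsum, sub_self, add_zero]
end

section
/- For all n×n positive definite matrices X and Y and all p > 0, Tr[X(log X^p + log Y^p)] ≤ Tr[X log(X^{p/2} Y^p X^{p/2})]. -/
open Matrix ComplexOrder

theorem Matrix.PosDef.re_inv_apply_le {n : Type*} [Fintype n] [DecidableEq n]
    {M N : Matrix n n ℂ} (hM : M.PosDef) (hN : N.PosDef) (h : (N - M).PosSemidef) (i : n) :
    (N⁻¹ i i).re ≤ (M⁻¹ i i).re := by
  have hMu := (Matrix.isUnit_iff_isUnit_det _).1 hM.isUnit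
  have hNu := (Matrix.isUnit_iff_isUnit_det _).1 hN.isUnit
  have key : M⁻¹ - N⁻¹ = (M⁻¹ - N⁻¹)ᴴ * M * (M⁻¹ - N⁻¹) + N⁻¹ᴴ * (N - M) * N⁻¹ := by
    rw [conjTranspose_sub, hM.inv.isHermitian.eq, hN.inv.isHermitian.eq]
    have e1 := Matrix.nonsing_inv_mul M hMu
    have e2 := Matrix.mul_nonsing_inv M hMu
    have e3 := Matrix.nonsing_inv_mul N hNu
    simp only [sub_mul, mul_sub, e1, e3, one_mul, mul_assoc, e2, mul_one]
    abel
  have hp : (M⁻¹ - N⁻¹).PosSemidef := by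
    rw [key]
    exact (hM.posSemidef.conjTranspose_mul_mul_same _).add (h.conjTranspose_mul_mul_same _)
  have := (Complex.le_def.1 (hp.diag_nonneg (i := i))).1
  simpa using this

theorem Matrix.IsHermitian.re_cfc_apply_self {n : Type*} [Fintype n] [DecidableEq n]
    {A : Matrix n n ℂ} (hA : A.IsHermitian) (f : ℝ → ℝ) (i : n) :
    (cfc f A i i).re =
      ∑ j, Complex.normSq ((hA.eigenvectorUnitary : Matrix n n ℂ) i j) * f (hA.eigenvalues j) := by
  rw [hA.cfc_eq f, Matrix.IsHermitian.cfc, Unitary.conjStarAlgAut_apply]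
  rw [Matrix.mul_apply, Complex.re_sum]
  refine Finset.sum_congr rfl fun j _ => ?_
  rw [Matrix.mul_diagonal]
  simp [Matrix.star_apply, Complex.normSq_apply]
  ring

theorem Matrix.IsHermitian.sum_normSq_eigenvectorUnitary {n : Type*} [Fintype n] [DecidableEq n]
    {A : Matrix n n ℂ} (hA : A.IsHermitian) (i : n) :
    ∑ j, Complex.normSq ((hA.eigenvectorUnitary : Matrix n n ℂ) i j) = 1 := by
  have := hA.re_cfc_apply_self (fun _ => 1) i
  simpa [cfc_const_one ℝ A hA.isSelfAdjoint] using this.symm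

theorem Matrix.PosDef.re_inv_add_smul_apply_self {n : Type*} [Fintype n] [DecidableEq n]
    {A : Matrix n n ℂ} (hA : A.PosDef) {t : ℝ} (ht : 0 ≤ t) (i : n) :
    (((A + diagonal fun _ => (t : ℂ) : Matrix n n ℂ)⁻¹ : Matrix n n ℂ) i i).re =
      ∑ j, Complex.normSq ((hA.isHermitian.eigenvectorUnitary : Matrix n n ℂ) i j) *
        (hA.isHermitian.eigenvalues j + t)⁻¹ := by
  rw [← hA.isHermitian.re_cfc_apply_self (fun x => (x + t)⁻¹)]
  have hfin : ∀ f : ℝ → ℝ, ContinuousOn f (spectrum ℝ A) := fun f =>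
    (Matrix.finite_real_spectrum (A := A)).continuousOn f
  have hsa : IsSelfAdjoint A := hA.isHermitian
  have e : A + (diagonal fun _ => (t : ℂ)) = cfc (fun x : ℝ => x + t) A := by
    rw [cfc_add_const t (fun x => x) A (hfin _) hsa, cfc_id' ℝ A hsa]
    rfl
  rw [e, Matrix.inv_eq_right_inv]
  rw [← cfc_mul _ _ A (hfin _) (hfin _), ← cfc_const_one ℝ A hsa]
  refine cfc_congr fun x hx => ?_
  rw [hA.isHermitian.spectrum_real_eq_range_eigenvalues] at hx
  obtain ⟨j, rfl⟩ := hx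
  have := hA.eigenvalues_pos j
  exact mul_inv_cancel₀ (by positivity)

theorem sum_mul_log_le_of_sum_mul_inv_le {ι : Type*} [Fintype ι] {w v a b : ι → ℝ}
    (ha : ∀ i, 0 < a i) (hb : ∀ i, 0 < b i) (hwv : ∑ i, w i = ∑ i, v i)
    (h : ∀ t > 0, ∑ i, w i * (a i + t)⁻¹ ≤ ∑ i, v i * (b i + t)⁻¹) :
    ∑ i, v i * Real.log (b i) ≤ ∑ i, w i * Real.log (a i) := by
  set G : ℝ → ℝ := fun t => ∑ i, w i * Real.log (a i + t) - ∑ i, v i * Real.log (b i + t) with hG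
  have hd : ∀ t ≥ 0, HasDerivAt G (∑ i, w i * (a i + t)⁻¹ - ∑ i, v i * (b i + t)⁻¹) t := by
    intro t ht
    have aux : ∀ (w a : ι → ℝ), (∀ i, 0 < a i) →
        HasDerivAt (fun t => ∑ i, w i * Real.log (a i + t)) (∑ i, w i * (a i + t)⁻¹) t := by
      intro w a ha
      refine HasDerivAt.fun_sum fun i _ => HasDerivAt.const_mul _ ?_
      have := ((hasDerivAt_id t).const_add (a i)).log (by have := ha i; simp; positivity)
      simpa using this
    exact (aux w a ha).sub (aux v b hb)
  have hanti : AntitoneOn G (Set.Ici 0) := by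
    refine antitoneOn_of_deriv_nonpos (convex_Ici 0)
      (fun t ht => (hd t ht).continuousAt.continuousWithinAt)
      (fun t ht => (hd t (interior_subset ht)).differentiableAt.differentiableWithinAt) ?_
    intro t ht
    rw [interior_Ici] at ht
    rw [(hd t (le_of_lt ht)).deriv]
    linarith [h t ht]
  have hlim : Filter.Tendsto G Filter.atTop (nhds 0) := by
    have aux : ∀ (w a : ι → ℝ), (∀ i, 0 < a i) →
        Filter.Tendsto (fun t => ∑ i, w i * (Real.log (a i + t) - Real.log t))
          Filter.atTop (nhds 0) := by
      intro w a ha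
      have := tendsto_finsetSum (Finset.univ : Finset ι) fun i _ =>
        ((Real.tendsto_log_comp_add_sub_log (a i)).const_mul (w i))
      simpa [add_comm] using this
    have := (aux w a ha).sub (aux v b hb)
    rw [sub_zero] at this
    refine this.congr fun t => ?_
    simp only [mul_sub, Finset.sum_sub_distrib, ← Finset.sum_mul, hwv, hG]
    ring
  have h0 : 0 ≤ G 0 := by
    refine le_of_tendsto hlim ?_
    filter_upwards [Filter.eventually_ge_atTop 0] with t ht
    exact hanti (Set.mem_Ici.2 le_rfl) ht ht
  simp only [hG, add_zero] at h0
  linarith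

theorem sum_mul_nonneg_of_upper_sums_nonneg {ι : Type*} [Fintype ι] {x d : ι → ℝ}
    (hx : ∀ i, 0 < x i)
    (h : ∀ τ > 0, 0 ≤ ∑ i with τ ≤ x i, d i) : 0 ≤ ∑ i, x i * d i := by
  suffices H : ∀ s : Finset ι, ∀ m ≥ 0, (∀ i ∈ s, m ≤ x i) →
      (∀ τ > m, 0 ≤ ∑ i ∈ s with τ ≤ x i, d i) → 0 ≤ ∑ i ∈ s, (x i - m) * d i by
    simpa using H Finset.univ 0 le_rfl (fun i _ => (hx i).le) h
  intro s
  induction s using Finset.strongInduction with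
  | H s ih =>
    intro m hm hms hsum
    rcases (s.filter fun i => m < x i).eq_empty_or_nonempty with he | hne
    · refine (Finset.sum_eq_zero fun i hi => ?_).ge
      have : ¬ m < x i := fun hlt => by
        have : i ∈ s.filter fun i => m < x i := by simp [hi, hlt]
        simp [he] at this
      rw [le_antisymm (not_lt.1 this) (hms i hi)]
      simp
    · obtain ⟨k, hk, hkmin⟩ := Finset.exists_min_image _ x hne
      rw [Finset.mem_filter] at hk
      have hlev : s.filter (fun i => x k ≤ x i) = s.filter (fun i => m < x i) := by
        ext i
        simp only [Finset.mem_filter, and_congr_right_iff]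
        intro hi
        exact ⟨fun h => hk.2.trans_le h, fun h => hkmin i (by simp [hi, h])⟩
      have hsub : s.filter (fun i => x k < x i) ⊂ s := by
        refine Finset.ssubset_iff_subset_ne.2 ⟨Finset.filter_subset _ _, fun he => ?_⟩
        have := hk.1
        rw [← he] at this
        simp at this
      have h1 := ih _ hsub (x k) (hm.trans hk.2.le) (fun i hi => (Finset.mem_filter.1 hi).2.le) (by
        intro τ hτ
        have := hsum τ (hk.2.trans hτ)
        have e : s.filter (fun i => x k < x i ∧ τ ≤ x i) = s.filter (fun i => τ ≤ x i) :=
          Finset.filter_congr fun i _ => ⟨fun h => h.2, fun h => ⟨hτ.trans_le h, h⟩⟩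
        rwa [Finset.filter_filter, e])
      have h2 := hsum (x k) hk.2
      have e1 : ∑ i ∈ s, (x i - m) * d i = ∑ i ∈ s with x k ≤ x i, (x i - m) * d i := by
        rw [hlev, Finset.sum_filter_of_ne]
        intro i hi hne
        refine lt_of_le_of_ne (hms i hi) fun he => hne ?_
        simp [he]
      have e2 : ∑ i ∈ s with x k < x i, (x i - x k) * d i
          = ∑ i ∈ s with x k ≤ x i, (x i - x k) * d i := by
        rw [show s.filter (fun i => x k < x i)
          = (s.filter (fun i => x k ≤ x i)).filter (fun i => x k < x i) by
            rw [Finset.filter_filter]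
            exact Finset.filter_congr fun i _ => ⟨fun h => ⟨h.le, h⟩, fun h => h.2⟩]
        rw [Finset.sum_filter_of_ne]
        intro i hi hne
        refine lt_of_le_of_ne (Finset.mem_filter.1 hi).2 fun he => hne ?_
        simp [he]
      have e3 : ∑ i ∈ s with x k ≤ x i, (x i - m) * d i
          = ∑ i ∈ s with x k ≤ x i, (x i - x k) * d i
            + (x k - m) * ∑ i ∈ s with x k ≤ x i, d i := by
        rw [Finset.mul_sum, ← Finset.sum_add_distrib]
        exact Finset.sum_congr rfl fun i _ => by ring
      rw [e1, e3, ← e2]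
      exact add_nonneg h1 (mul_nonneg (sub_nonneg.2 hk.2.le) h2)

theorem Matrix.PosDef.sum_re_cfc_log_apply_self {n : Type*} [Fintype n] [DecidableEq n]
    {A : Matrix n n ℂ} (hA : A.PosDef) :
    ∑ i, (cfc Real.log A i i).re = Real.log A.det.re := by
  rw [hA.isHermitian.det_eq_prod_eigenvalues]
  simp_rw [hA.isHermitian.re_cfc_apply_self]
  rw [Finset.sum_comm]
  have hcol : ∀ j, ∑ i, Complex.normSq
      ((hA.isHermitian.eigenvectorUnitary : Matrix n n ℂ) i j) = 1 := by
    intro j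
    have := congr_fun (congr_fun
      (Unitary.coe_star_mul_self hA.isHermitian.eigenvectorUnitary) j) j
    rw [Matrix.mul_apply] at this
    have := congrArg Complex.re this
    simpa [Matrix.star_apply, Complex.normSq_apply] using this
  simp_rw [← Finset.sum_mul, hcol, one_mul]
  have : (∏ i, ((hA.isHermitian.eigenvalues i : ℝ) : ℂ)).re = ∏ i, hA.isHermitian.eigenvalues i := by
    rw [← Complex.ofReal_prod, Complex.ofReal_re]
  exact (Real.log_prod fun i _ => (hA.eigenvalues_pos i).ne').symm.trans (congrArg _ this.symm)

theorem Matrix.PosDef.diagonal_mul_mul_diagonal {n : Type*} [Fintype n] [DecidableEq n]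
    {B : Matrix n n ℂ} (hB : B.PosDef) {k : n → ℝ} (hk : ∀ i, 0 < k i) :
    (diagonal (fun i => (k i : ℂ)) * B * diagonal (fun i => (k i : ℂ))).PosDef := by
  have hd : (diagonal fun i => (k i : ℂ)).PosDef :=
    Matrix.PosDef.diagonal fun i => by exact_mod_cast hk i
  have := (Matrix.IsUnit.posDef_star_left_conjugate_iff (x := B) hd.isUnit).2 hB
  rwa [Matrix.star_eq_conjTranspose, hd.isHermitian.eq] at this

theorem Matrix.PosDef.re_cfc_log_apply_self_add_le {n : Type*} [Fintype n] [DecidableEq n]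
    {B : Matrix n n ℂ} (hB : B.PosDef) {k : n → ℝ} (hk : ∀ i, 0 < k i) {i : n}
    (hi : ∀ j, k j ≤ k i) :
    (cfc Real.log B i i).re + 2 * Real.log (k i) ≤
      (cfc Real.log (diagonal (fun i => (k i : ℂ)) * B * diagonal (fun i => (k i : ℂ))) i i).re := by
  have hC := hB.diagonal_mul_mul_diagonal hk
  set C := diagonal (fun i => (k i : ℂ)) * B * diagonal (fun i => (k i : ℂ)) with hCdef
  have hki := hk i
  have hBs := hB.isHermitian.sum_normSq_eigenvectorUnitary i
  have hCs := hC.isHermitian.sum_normSq_eigenvectorUnitary i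
  have key := sum_mul_log_le_of_sum_mul_inv_le
    (w := fun j => Complex.normSq ((hC.isHermitian.eigenvectorUnitary : Matrix n n ℂ) i j))
    (v := fun j => Complex.normSq ((hB.isHermitian.eigenvectorUnitary : Matrix n n ℂ) i j))
    (a := hC.isHermitian.eigenvalues)
    (b := fun j => k i ^ 2 * hB.isHermitian.eigenvalues j)
    hC.eigenvalues_pos (fun j => mul_pos (by positivity) (hB.eigenvalues_pos j))
    (hCs.trans hBs.symm) ?_
  · rw [hB.isHermitian.re_cfc_apply_self, hC.isHermitian.re_cfc_apply_self]
    refine le_trans (le_of_eq ?_) key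
    have : ∀ j, Real.log (k i ^ 2 * hB.isHermitian.eigenvalues j) =
        Real.log (hB.isHermitian.eigenvalues j) + 2 * Real.log (k i) := by
      intro j
      rw [Real.log_mul (by positivity) (hB.eigenvalues_pos j).ne', Real.log_pow]
      push_cast
      ring
    simp_rw [this, mul_add, Finset.sum_add_distrib, ← Finset.sum_mul, hBs]
    ring
  · intro t ht
    rw [← hC.re_inv_add_smul_apply_self ht.le]
    have e1 : ∑ j, Complex.normSq ((hB.isHermitian.eigenvectorUnitary : Matrix n n ℂ) i j) *
          (k i ^ 2 * hB.isHermitian.eigenvalues j + t)⁻¹ =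
        (k i ^ 2)⁻¹ * (((B + diagonal fun _ => ((t / k i ^ 2 : ℝ) : ℂ) : Matrix n n ℂ)⁻¹ :
          Matrix n n ℂ) i i).re := by
      rw [hB.re_inv_add_smul_apply_self (by positivity), Finset.mul_sum]
      refine Finset.sum_congr rfl fun j _ => ?_
      have := hB.eigenvalues_pos j
      rw [show k i ^ 2 * hB.isHermitian.eigenvalues j + t =
        k i ^ 2 * (hB.isHermitian.eigenvalues j + t / k i ^ 2) by field_simp, mul_inv]
      ring
    rw [e1]
    have hD : ∀ f : n → ℝ, (∀ j, 0 < f j) → (B + diagonal fun j => (f j : ℂ)).PosDef :=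
      fun f hf => hB.add (Matrix.PosDef.diagonal fun j => by exact_mod_cast hf j)
    have hN := hD (fun j => t / k j ^ 2) (fun j => by have := hk j; positivity)
    have hM := hD (fun _ => t / k i ^ 2) (fun j => by positivity)
    have e2 : ((C + diagonal fun _ => (t : ℂ) : Matrix n n ℂ)⁻¹ : Matrix n n ℂ) =
        diagonal (fun j => ((k j)⁻¹ : ℂ)) *
          (B + diagonal fun j => ((t / k j ^ 2 : ℝ) : ℂ) : Matrix n n ℂ)⁻¹ *
          diagonal (fun j => ((k j)⁻¹ : ℂ)) := by
      have e3 : C + (diagonal fun _ => (t : ℂ)) = diagonal (fun j => (k j : ℂ)) *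
          (B + diagonal fun j => ((t / k j ^ 2 : ℝ) : ℂ)) * diagonal (fun j => (k j : ℂ)) := by
        rw [hCdef, mul_add, add_mul, diagonal_mul_diagonal, diagonal_mul_diagonal]
        congr 2
        ext j
        have : (k j : ℂ) ≠ 0 := by exact_mod_cast (hk j).ne'
        push_cast
        field_simp
      have e4 : (diagonal fun j => (k j : ℂ))⁻¹ = diagonal (fun j => ((k j)⁻¹ : ℂ)) := by
        refine Matrix.inv_eq_right_inv ?_
        rw [diagonal_mul_diagonal, ← diagonal_one]
        congr 1
        ext j
        exact mul_inv_cancel₀ (by exact_mod_cast (hk j).ne')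
      rw [e3, Matrix.mul_inv_rev, Matrix.mul_inv_rev, e4, mul_assoc]
    have e5 : (((C + diagonal fun _ => (t : ℂ) : Matrix n n ℂ)⁻¹ : Matrix n n ℂ) i i).re =
        (k i ^ 2)⁻¹ * (((B + diagonal fun j => ((t / k j ^ 2 : ℝ) : ℂ) : Matrix n n ℂ)⁻¹ :
          Matrix n n ℂ) i i).re := by
      rw [e2, mul_diagonal, diagonal_mul, mul_right_comm, ← Complex.ofReal_inv,
        ← Complex.ofReal_mul, Complex.re_ofReal_mul]
      ring
    rw [e5]
    refine mul_le_mul_of_nonneg_left (hM.re_inv_apply_le hN ?_ i) (by positivity)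
    rw [add_sub_add_left_eq_sub, diagonal_sub]
    refine Matrix.PosSemidef.diagonal fun j => ?_
    rw [← Complex.ofReal_sub]
    have : t / k i ^ 2 ≤ t / k j ^ 2 := by
      have := hk j
      have := hi j
      gcongr
    exact Complex.zero_le_real.2 (sub_nonneg.2 this)

theorem Matrix.PosDef.le_re_cfc_log_apply_self_add {n : Type*} [Fintype n] [DecidableEq n]
    {B : Matrix n n ℂ} (hB : B.PosDef) {k : n → ℝ} (hk : ∀ i, 0 < k i) {i : n}
    (hi : ∀ j, k i ≤ k j) :
    (cfc Real.log (diagonal (fun i => (k i : ℂ)) * B * diagonal (fun i => (k i : ℂ))) i i).re ≤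
      (cfc Real.log B i i).re + 2 * Real.log (k i) := by
  have := (hB.diagonal_mul_mul_diagonal hk).re_cfc_log_apply_self_add_le
    (k := fun j => (k j)⁻¹) (fun j => inv_pos.2 (hk j)) (i := i)
    (fun j => inv_anti₀ (hk i) (hi j))
  have e : ∀ j, (k j : ℂ)⁻¹ * (k j : ℂ) = 1 := fun j =>
    inv_mul_cancel₀ (by exact_mod_cast (hk j).ne')
  have e' : ∀ j, (k j : ℂ) * (k j : ℂ)⁻¹ = 1 := fun j =>
    mul_inv_cancel₀ (by exact_mod_cast (hk j).ne')
  rw [show ∀ D E : Matrix n n ℂ, E * (D * B * D) * E = (E * D) * B * (D * E) from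
    fun D E => by simp only [mul_assoc]] at this
  simp only [diagonal_mul_diagonal, Complex.ofReal_inv, e, e', diagonal_one, one_mul, mul_one,
    Real.log_inv] at this
  linarith

theorem Matrix.PosDef.sum_upper_re_cfc_log_le {n : Type*} [Fintype n] [DecidableEq n]
    {B : Matrix n n ℂ} (hB : B.PosDef) {c : n → ℝ} (hc : ∀ i, 0 < c i) {τ : ℝ} (hτ : 0 < τ) :
    ∑ i with τ ≤ c i, ((cfc Real.log B i i).re + 2 * Real.log (c i)) ≤
      ∑ i with τ ≤ c i, (cfc Real.log
        (diagonal (fun i => (c i : ℂ)) * B * diagonal (fun i => (c i : ℂ))) i i).re := by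
  set k : n → ℝ := fun i => max (c i) τ with hk
  set l : n → ℝ := fun i => min (c i / τ) 1 with hl
  have hk0 : ∀ i, 0 < k i := fun i => lt_max_of_lt_right hτ
  have hl0 : ∀ i, 0 < l i := fun i => lt_min (div_pos (hc i) hτ) one_pos
  have hkl : ∀ i, l i * k i = c i := by
    intro i
    rcases le_total τ (c i) with h | h
    · simp [hk, hl, max_eq_left h, min_eq_right ((one_le_div hτ).2 h)]
    · simp [hk, hl, max_eq_right h, min_eq_left ((div_le_one hτ).2 h), hτ.ne']
  have hB₁ := hB.diagonal_mul_mul_diagonal hk0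
  set B₁ := diagonal (fun i => (k i : ℂ)) * B * diagonal (fun i => (k i : ℂ)) with hB₁def
  have hZ : diagonal (fun i => (c i : ℂ)) * B * diagonal (fun i => (c i : ℂ)) =
      diagonal (fun i => (l i : ℂ)) * B₁ * diagonal (fun i => (l i : ℂ)) := by
    rw [hB₁def, show ∀ D E : Matrix n n ℂ, E * (D * B * D) * E = (E * D) * B * (D * E) from
      fun D E => by simp only [mul_assoc]]
    simp only [diagonal_mul_diagonal, ← Complex.ofReal_mul, hkl, mul_comm (k _)]
  have hup : ∑ i with τ ≤ c i, (cfc Real.log B₁ i i).re ≤ ∑ i with τ ≤ c i, (cfc Real.log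
        (diagonal (fun i => (c i : ℂ)) * B * diagonal (fun i => (c i : ℂ))) i i).re := by
    refine Finset.sum_le_sum fun i hi => ?_
    have hi' : l i = 1 := by
      simp [hl, (one_le_div hτ).2 (Finset.mem_filter.1 hi).2]
    have := hB₁.re_cfc_log_apply_self_add_le hl0 (i := i)
      (fun j => hi'.symm ▸ min_le_right _ _)
    rw [hi', Real.log_one, mul_zero, add_zero] at this
    rwa [hZ]
  refine le_trans ?_ hup
  have hlow : ∑ i with ¬ τ ≤ c i, (cfc Real.log B₁ i i).re ≤
      ∑ i with ¬ τ ≤ c i, ((cfc Real.log B i i).re + 2 * Real.log (k i)) := by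
    refine Finset.sum_le_sum fun i hi => ?_
    have hi' : k i = τ := max_eq_right (not_le.1 (Finset.mem_filter.1 hi).2).le
    exact hB.le_re_cfc_log_apply_self_add hk0 fun j => hi'.symm ▸ le_max_right _ _
  have htot : ∑ i, (cfc Real.log B₁ i i).re =
      ∑ i, ((cfc Real.log B i i).re + 2 * Real.log (k i)) := by
    rw [Finset.sum_add_distrib, hB.sum_re_cfc_log_apply_self, hB₁.sum_re_cfc_log_apply_self, hB₁def,
      det_mul, det_mul, det_diagonal, ← Complex.ofReal_prod, mul_right_comm, ← Complex.ofReal_mul,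
      Complex.re_ofReal_mul, ← Finset.mul_sum, ← Real.log_prod fun i _ => (hk0 i).ne']
    have hp : 0 < ∏ i, k i := Finset.prod_pos fun i _ => hk0 i
    have hd : 0 < B.det.re := (Complex.lt_def.1 hB.det_pos).1
    rw [Real.log_mul (by positivity) hd.ne', Real.log_mul hp.ne' hp.ne']
    ring
  rw [← Finset.sum_filter_add_sum_filter_not Finset.univ (fun i => τ ≤ c i),
    ← Finset.sum_filter_add_sum_filter_not Finset.univ (fun i => τ ≤ c i)
      (fun i => (cfc Real.log B i i).re + 2 * Real.log (k i))] at htot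
  have hc' : ∑ i with τ ≤ c i, ((cfc Real.log B i i).re + 2 * Real.log (c i)) =
      ∑ i with τ ≤ c i, ((cfc Real.log B i i).re + 2 * Real.log (k i)) := by
    refine Finset.sum_congr rfl fun i hi => ?_
    rw [show k i = c i from max_eq_left (Finset.mem_filter.1 hi).2]
  linarith

theorem Matrix.cfc_conjStarAlgAut {n : Type*} [Fintype n] [DecidableEq n] {A : Matrix n n ℂ}
    (hA : A.IsHermitian) (u : unitary (Matrix n n ℂ)) (f : ℝ → ℝ) :
    cfc f (Unitary.conjStarAlgAut ℂ _ u A) = Unitary.conjStarAlgAut ℂ _ u (cfc f A) := by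
  have hsa : IsSelfAdjoint A := hA
  refine (StarAlgHomClass.map_cfc (S := ℂ) (Unitary.conjStarAlgAut ℂ (Matrix n n ℂ) u) f A
    ((Matrix.finite_real_spectrum (A := A)).continuousOn f) ?_ hsa (hsa.map _)).symm
  change Continuous fun x : Matrix n n ℂ => (u : Matrix n n ℂ) * x * star (u : Matrix n n ℂ)
  fun_prop

theorem stmt4 {n : Type*} [Fintype n] [DecidableEq n]
    (X Y : Matrix n n ℂ) (hX : X.PosDef) (hY : Y.PosDef) (p : ℝ) (hp : 0 < p) :
    rtr (X * (mlog (mpow X p) + mlog (mpow Y p))) ≤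
      rtr (X * mlog (mpow X (p / 2) * mpow Y p * mpow X (p / 2))) := by
  set lam := hX.isHermitian.eigenvalues with hlam
  have hpos : ∀ i, 0 < lam i := hX.eigenvalues_pos
  set φ := Unitary.conjStarAlgAut ℂ (Matrix n n ℂ) hX.isHermitian.eigenvectorUnitary with hφ
  have hXf : ∀ f : ℝ → ℝ, cfc f X = φ (diagonal fun i => (f (lam i) : ℂ)) :=
    fun f => hX.isHermitian.cfc_eq f
  have hXφ : X = φ (diagonal fun i => (lam i : ℂ)) := hX.isHermitian.spectral_theorem
  have htr : ∀ M : Matrix n n ℂ, rtr (X * φ M) = ∑ i, lam i * (M i i).re := by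
    intro M
    have : (φ (diagonal (fun i => (lam i : ℂ)) * M)).trace =
        (diagonal (fun i => (lam i : ℂ)) * M).trace := by
      rw [hφ, Unitary.conjStarAlgAut_apply, trace_mul_cycle, Unitary.coe_star_mul_self, one_mul]
    rw [hXφ, ← map_mul, rtr, this]
    simp [trace]
  have hYp : (mpow Y p).PosDef := by
    have hH : (mpow Y p).IsHermitian := cfc_predicate (R := ℝ) _ Y
    have hc := hY.isHermitian.cfc_eq (fun x => x ^ p)
    rw [mpow, hc, Matrix.IsHermitian.cfc, Unitary.conjStarAlgAut_apply]
    refine (Matrix.IsUnit.posDef_star_right_conjugate_iff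
      (Unitary.isUnit_coe (U := hY.isHermitian.eigenvectorUnitary))).2 ?_
    refine Matrix.PosDef.diagonal fun i => ?_
    have := Real.rpow_pos_of_pos (hY.eigenvalues_pos i) p
    simpa using this
  set B := φ.symm (mpow Y p) with hBdef
  have hYB : mpow Y p = φ B := (φ.apply_symm_apply _).symm
  have hB : B.PosDef := by
    rw [hBdef, hφ, Unitary.conjStarAlgAut_symm_apply]
    exact (Matrix.IsUnit.posDef_star_left_conjugate_iff
      (Unitary.isUnit_coe (U := hX.isHermitian.eigenvectorUnitary))).2 hYp
  set c : n → ℝ := fun i => lam i ^ (p / 2) with hcdef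
  have hc : ∀ i, 0 < c i := fun i => Real.rpow_pos_of_pos (hpos i) _
  have hZ := hB.diagonal_mul_mul_diagonal hc
  set Z := diagonal (fun i => (c i : ℂ)) * B * diagonal (fun i => (c i : ℂ)) with hZdef
  have hR : mlog (mpow X (p / 2) * mpow Y p * mpow X (p / 2)) = φ (cfc Real.log Z) := by
    rw [hYB, show mpow X (p / 2) = φ (diagonal fun i => (c i : ℂ)) from hXf _, ← map_mul,
      ← map_mul, mlog, hφ, Matrix.cfc_conjStarAlgAut hZ.isHermitian]
  have hLY : mlog (mpow Y p) = φ (cfc Real.log B) := by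
    rw [hYB, mlog, hφ, Matrix.cfc_conjStarAlgAut hB.isHermitian]
  have hLX : mlog (mpow X p) = φ (diagonal fun i => ((2 * Real.log (c i) : ℝ) : ℂ)) := by
    have hfin := Matrix.finite_real_spectrum (A := X)
    have hcomp : cfc (fun x : ℝ => Real.log (x ^ p)) X = mlog (mpow X p) :=
      cfc_comp' Real.log (fun x : ℝ => x ^ p) X ((hfin.image _).continuousOn _)
        (hfin.continuousOn _) hX.isHermitian
    rw [← hcomp, hXf]
    congr 2
    ext i
    rw [hcdef, Real.log_rpow (hpos i), Real.log_rpow (hpos i)]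
    congr 1
    ring
  rw [hR, hLX, hLY, ← map_add, htr, htr, ← sub_nonneg, ← Finset.sum_sub_distrib]
  simp_rw [← mul_sub]
  refine sum_mul_nonneg_of_upper_sums_nonneg hpos fun τ hτ => ?_
  have hlevel : ∀ i, τ ≤ lam i ↔ τ ^ (p / 2) ≤ c i := fun i =>
    (Real.rpow_le_rpow_iff hτ.le (hpos i).le (half_pos hp)).symm
  simp_rw [hlevel]
  have := hB.sum_upper_re_cfc_log_le hc (Real.rpow_pos_of_pos hτ (p / 2))
  rw [Finset.sum_sub_distrib, sub_nonneg]
  refine le_trans (le_of_eq (Finset.sum_congr rfl fun i _ => ?_)) this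
  rw [Matrix.add_apply, diagonal_apply_eq, Complex.add_re, Complex.ofReal_re, add_comm]
end
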